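/- arXiv:1512.04717 — 4 statements merged into one kernel-verified Lean document; each statement's English description precedes it below -/
import Mathlib

section
/- Let K ⊆ ℂ be compact. Then ℂ \ K is connected if and only if for every open set A with K ⊆ A there exists an open set V with K ⊆ V ⊆ A such that every connected component of V is simply connected. -/
open Set Filter Topology

/-- A space which is homotopy dominated by a simply connected space is simply connected. -/
theorem SimplyConnectedSpace.of_homotopy_comp_id {X Y : Type*} [TopologicalSpace X]
    [TopologicalSpace Y] [SimplyConnectedSpace Y] (i : C(X, Y)) (r : C(Y, X))
    (F : (ContinuousMap.id X).Homotopy (r.comp i)) : SimplyConnectedSpace X := by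
  have hpc : PathConnectedSpace X := by
    refine ⟨⟨r (Classical.arbitrary Y)⟩, fun x y => ?_⟩
    have h : Joined (r (i x)) (r (i y)) :=
      (PathConnectedSpace.joined (i x) (i y)).map r.continuous
    have hx : ∀ x, Joined x (r (i x)) := fun x => ⟨F.evalAt x⟩
    exact ((hx x).trans h).trans (hx y).symm
  refine simply_connected_iff_paths_homotopic'.2 ⟨hpc, fun {x y} p q => ?_⟩
  let e : ∀ x, Path x (r.comp i x) := fun x => F.evalAt x
  have key : ∀ p : Path x y, (p.trans (e y)).Homotopic
      ((e x).trans (p.map (r.comp i).continuous)) := fun p =>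
    Path.Homotopic.map_trans_evalAt F p
  have hpq : (p.map (r.comp i).continuous).Homotopic (q.map (r.comp i).continuous) :=
    (SimplyConnectedSpace.paths_homotopic (p.map i.continuous) (q.map i.continuous)).map r
  have h : (p.trans (e y)).Homotopic (q.trans (e y)) :=
    (key p).trans (((Path.Homotopic.refl _).hcomp hpq).trans (key q).symm)
  have h2 := Path.Homotopic.Quotient.eq.2 h
  rw [Path.Homotopic.Quotient.mk_trans, Path.Homotopic.Quotient.mk_trans] at h2
  have h3 := congrArg (fun t => Path.Homotopic.Quotient.trans t
    (Path.Homotopic.Quotient.symm (Path.Homotopic.Quotient.mk (e y)))) h2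
  rw [← Path.Homotopic.Quotient.eq]
  simpa using h3

/-- A set `W` with maps `i : W → U` and `r : U → W`, with `U` simply connected, such that the
segments from `z` to `r (i z)` stay in `W`, is simply connected. -/
theorem IsSimplyConnected.of_segment_subset {U W : Set ℂ} (hU : IsSimplyConnected U) {i r : ℂ → ℂ}
    (hi : ContinuousOn i W) (hr : ContinuousOn r U) (hiW : MapsTo i W U) (hrU : MapsTo r U W)
    (hseg : ∀ z ∈ W, segment ℝ z (r (i z)) ⊆ W) : IsSimplyConnected W := by
  have := hU.simplyConnectedSpace
  let iMap : C(W, U) := ⟨hiW.restrict, hi.mapsToRestrict hiW⟩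
  let rMap : C(U, W) := ⟨hrU.restrict, hr.mapsToRestrict hrU⟩
  have hmem : ∀ p : unitInterval × W,
      AffineMap.lineMap (k := ℝ) (p.2 : ℂ) (r (i p.2)) (p.1 : ℝ) ∈ W := fun p =>
    hseg _ p.2.2 (by
      rw [segment_eq_image_lineMap]
      exact ⟨_, p.1.2, rfl⟩)
  have hc : Continuous fun p : unitInterval × W =>
      AffineMap.lineMap (k := ℝ) (p.2 : ℂ) (r (i p.2)) (p.1 : ℝ) := by
    have h1 : Continuous fun w : W => r (i w) :=
      continuous_subtype_val.comp (rMap.comp iMap).continuous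
    simp only [AffineMap.lineMap_apply_module]
    have h2 : Continuous fun p : unitInterval × W => r (i p.2) := h1.comp continuous_snd
    have h3 : Continuous fun p : unitInterval × W => (p.1 : ℝ) :=
      continuous_subtype_val.comp continuous_fst
    have h4 : Continuous fun p : unitInterval × W => (p.2 : ℂ) :=
      continuous_subtype_val.comp continuous_snd
    exact ((continuous_const.sub h3).smul h4).add (h3.smul h2)
  exact SimplyConnectedSpace.of_homotopy_comp_id iMap rMap
    { toFun := fun p => ⟨_, hmem p⟩
      continuous_toFun := hc.subtype_mk _
      map_zero_left := fun w => by ext1; simp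
      map_one_left := fun w => by ext1; simp [iMap, rMap] }

/-- Two continuous logarithms of the same function on a connected space which agree at a point
are equal. -/
theorem Complex.eq_of_exp_comp_eq {X : Type*} [TopologicalSpace X] [PreconnectedSpace X]
    {f g : X → ℂ} (hf : Continuous f) (hg : Continuous g)
    (h : ∀ x, Complex.exp (f x) = Complex.exp (g x)) {a : X} (ha : f a = g a) : f = g :=
  Complex.isCoveringMap_exp.eq_of_comp_eq hf hg (funext fun x => Subtype.ext (h x)) a ha

/-- The part above the real axis of an open simply connected set containing the real axis is
simply connected. -/
theorem IsSimplyConnected.inter_im_pos {U : Set ℂ} (hU : IsSimplyConnected U) (hUo : IsOpen U)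
    (hR : ∀ x : ℝ, (x : ℂ) ∈ U) : IsSimplyConnected (U ∩ {z | 0 < z.im}) := by
  obtain ⟨δ, hδc, hδ0, hδU⟩ : ∃ δ : ℝ → ℝ, Continuous δ ∧ (∀ x, 0 < δ x) ∧
      ∀ z : ℂ, 0 ≤ z.im → z.im ≤ δ z.re → z ∈ U := by
    by_cases hne : (Uᶜ).Nonempty
    · refine ⟨fun x => Metric.infDist (x : ℂ) Uᶜ / 2, ?_, fun x => ?_, fun z h0 h1 => ?_⟩
      · exact ((Metric.continuous_infDist_pt _).comp Complex.continuous_ofReal).div_const 2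
      · have := (hUo.isClosed_compl.notMem_iff_infDist_pos hne).1 (not_not.2 (hR x))
        positivity
      · by_contra hz
        have h2 : Metric.infDist (z.re : ℂ) Uᶜ ≤ dist (z.re : ℂ) z :=
          Metric.infDist_le_dist_of_mem hz
        have h3 : dist (z.re : ℂ) z = z.im := by
          rw [Complex.dist_of_re_eq (by simp)]
          simp [abs_of_nonneg h0]
        have := (hUo.isClosed_compl.notMem_iff_infDist_pos hne).1 (not_not.2 (hR z.re))
        linarith
    · rw [not_nonempty_iff_eq_empty, compl_empty_iff] at hne
      exact ⟨fun _ => 1, continuous_const, fun _ => one_pos, fun z _ _ => hne ▸ mem_univ z⟩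
  refine hU.of_segment_subset (i := id) (r := fun z => ⟨z.re, max z.im (δ z.re)⟩)
    continuousOn_id ?_ (fun z hz => hz.1) (fun z hz => ?_) (fun z hz => ?_)
  · refine Continuous.continuousOn ?_
    have : Continuous fun z : ℂ => (z.re, max z.im (δ z.re)) := by fun_prop
    exact Complex.equivRealProdCLM.symm.continuous.comp this
  · refine ⟨?_, lt_max_of_lt_right (hδ0 _)⟩
    rcases le_total (δ z.re) z.im with h | h
    · simpa only [max_eq_left h] using hz
    · simp only [max_eq_right h]
      exact hδU _ (hδ0 _).le le_rfl
  · rcases le_total (δ z.re) z.im with h | h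
    · simp only [id, max_eq_left h]
      rw [show (⟨z.re, z.im⟩ : ℂ) = z from rfl, segment_same]
      exact singleton_subset_iff.2 hz
    · have hz0 : 0 < z.im := hz.2
      simp only [id, max_eq_right h]
      rintro w ⟨a, b, ha, hb, hab, rfl⟩
      have hre : (a • z + b • (⟨z.re, δ z.re⟩ : ℂ)).re = z.re := by
        simp [← add_mul, hab]
      have him : (a • z + b • (⟨z.re, δ z.re⟩ : ℂ)).im = a * z.im + b * δ z.re := by simp
      have h1 : z.im ≤ a * z.im + b * δ z.re := by nlinarith
      have h2 : a * z.im + b * δ z.re ≤ δ z.re := by nlinarith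
      refine ⟨hδU _ ?_ ?_, ?_⟩
      · rw [him]; linarith
      · rw [him, hre]; exact h2
      · rw [mem_ofPred_eq, him]; linarith

/-- If a chart `L` of an open simply connected set `U` covers the real axis, then the part of `U`
above the real axis in this chart is simply connected. -/
theorem IsSimplyConnected.inter_im_comp_pos {U : Set ℂ} (hU : IsSimplyConnected U) {L E : ℂ → ℂ}
    (hL : ContinuousOn L U) (hE : ContinuousOn E (L '' U)) (hEL : LeftInvOn E L U)
    (ho : IsOpen (L '' U)) (hR : ∀ x : ℝ, (x : ℂ) ∈ L '' U) :
    IsSimplyConnected (U ∩ {z | 0 < (L z).im}) := by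
  have hEU : MapsTo E (L '' U) U := by
    rintro _ ⟨z, hz, rfl⟩
    rwa [hEL hz]
  have hLE : ∀ w ∈ L '' U, L (E w) = w := by
    rintro _ ⟨z, hz, rfl⟩
    rw [hEL hz]
  have h1 : IsSimplyConnected (L '' U) := by
    refine hU.of_segment_subset hE hL hEU (mapsTo_image L U) fun w hw => ?_
    rw [hLE w hw, segment_same]
    exact singleton_subset_iff.2 hw
  refine (h1.inter_im_pos ho hR).of_segment_subset (i := L) (r := E)
    (hL.mono inter_subset_left) (hE.mono inter_subset_left)
    (fun z hz => ⟨mem_image_of_mem L hz.1, hz.2⟩) (fun w hw => ⟨hEU hw.1, ?_⟩) fun z hz => ?_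
  · rw [mem_ofPred_eq, hLE w hw.1]
    exact hw.2
  · rw [hEL hz.1, segment_same]
    exact singleton_subset_iff.2 hz

/-- Cutting an open simply connected set along a crosscut yields two simply connected pieces. -/
theorem IsSimplyConnected.exists_diff_crosscut {U : Set ℂ} (hU : IsSimplyConnected U)
    (hUo : IsOpen U) (h0 : (0 : ℂ) ∉ U) (h1 : (1 : ℂ) ∉ U)
    (hQ : ∀ x ∈ Ioo (0 : ℝ) 1, (x : ℂ) ∈ U) :
    ∃ P N : Set ℂ, IsOpen P ∧ IsOpen N ∧ Disjoint P N ∧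
      P ∪ N = U \ (Complex.ofReal '' Icc 0 1) ∧ IsSimplyConnected P ∧ IsSimplyConnected N := by
  have hne0 : ∀ z ∈ U, z ≠ 0 := fun z hz h => h0 (h ▸ hz)
  have hne1 : ∀ z ∈ U, 1 - z ≠ 0 := fun z hz h => h1 (by rwa [sub_eq_zero.1 h])
  obtain ⟨L₀, hL₀, hexp₀⟩ := Complex.exists_continuousOn_eqOn_exp_comp hU hUo
    (g := fun z => z / (1 - z))
    (continuousOn_id.div (continuousOn_const.sub continuousOn_id) hne1) (by
      rintro ⟨z, hz, h⟩
      exact div_ne_zero (hne0 z hz) (hne1 z hz) h)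
  have hhalf : ((1 / 2 : ℝ) : ℂ) ∈ U := hQ _ (by norm_num)
  have hc : Complex.exp (L₀ (1 / 2 : ℝ)) = 1 := by
    have := hexp₀ hhalf
    simp only [Function.comp] at this
    rw [this]
    norm_num
  set L : ℂ → ℂ := fun z => L₀ z - L₀ (1 / 2 : ℝ) with hLdef
  have hL : ContinuousOn L U := hL₀.sub continuousOn_const
  have hexp : ∀ z ∈ U, Complex.exp (L z) = z / (1 - z) := fun z hz => by
    have := hexp₀ hz
    simp only [Function.comp] at this
    rw [hLdef, Complex.exp_sub, hc, this, div_one]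
  let E : ℂ → ℂ := fun w => Complex.exp w / (1 + Complex.exp w)
  have hone : ∀ z ∈ U, 1 + Complex.exp (L z) = 1 / (1 - z) := fun z hz => by
    rw [hexp z hz]
    field_simp [hne1 z hz]
    ring
  have hEL : LeftInvOn E L U := fun z hz => by
    change Complex.exp (L z) / (1 + Complex.exp (L z)) = z
    rw [hone z hz, hexp z hz]
    field_simp [hne1 z hz]
  have hEd : ∀ w ∈ L '' U, 1 + Complex.exp w ≠ 0 := by
    rintro _ ⟨z, hz, rfl⟩
    rw [hone z hz]
    exact one_div_ne_zero (hne1 z hz)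
  have hEc : ∀ w, 1 + Complex.exp w ≠ 0 → ContinuousAt E w := fun w hw =>
    Complex.continuous_exp.continuousAt.div
      (continuous_const.add Complex.continuous_exp).continuousAt hw
  have hexpE : ∀ w, 1 + Complex.exp w ≠ 0 → E w / (1 - E w) = Complex.exp w := fun w hw => by
    have : 1 - E w = 1 / (1 + Complex.exp w) := by
      simp only [E]
      field_simp
      ring
    rw [this]
    simp only [E]
    field_simp
  have ho : IsOpen (L '' U) := by
    rw [isOpen_iff_mem_nhds]
    rintro _ ⟨z, hz, rfl⟩
    have hd := hEd _ (mem_image_of_mem L hz)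
    have hEat := hEc _ hd
    have hEz : E (L z) = z := hEL hz
    have hEU : ∀ᶠ w in 𝓝 (L z), E w ∈ U := hEat.eventually_mem (by
      rw [hEz]; exact hUo.mem_nhds hz)
    have hLat : ContinuousAt (fun w => L (E w)) (L z) :=
      ContinuousAt.comp (by rw [hEz]; exact hL.continuousAt (hUo.mem_nhds hz)) hEat
    have hsub : ContinuousAt (fun w => L (E w) - w) (L z) := hLat.sub continuousAt_id
    have hsmall : ∀ᶠ w in 𝓝 (L z), L (E w) - w ∈ Metric.ball (0 : ℂ) (2 * Real.pi) :=
      hsub.eventually_mem (by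
        rw [hEz, sub_self]
        exact Metric.ball_mem_nhds _ Real.two_pi_pos)
    have hd' : ∀ᶠ w in 𝓝 (L z), 1 + Complex.exp w ≠ 0 :=
      (continuous_const.add Complex.continuous_exp).continuousAt.eventually_ne hd
    filter_upwards [hEU, hsmall, hd'] with w hw1 hw2 hw3
    refine ⟨E w, hw1, ?_⟩
    have h := hexp _ hw1
    rw [hexpE w hw3] at h
    obtain ⟨n, hn⟩ := Complex.exp_eq_exp_iff_exists_int.1 h
    rw [hn, add_sub_cancel_left, mem_ball_zero_iff] at hw2
    have hn0 : n = 0 := by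
      by_contra hn0
      have : (1 : ℝ) ≤ |(n : ℝ)| := by exact_mod_cast Int.one_le_abs hn0
      simp [abs_of_pos Real.pi_pos] at hw2
      nlinarith [Real.pi_pos]
    rw [hn, hn0]
    simp
  have hEreal : ∀ x : ℝ, ∃ y ∈ Ioo (0 : ℝ) 1, E x = (y : ℂ) := fun x => by
    refine ⟨Real.exp x / (1 + Real.exp x), ⟨by positivity, ?_⟩, by simp [E]⟩
    rw [div_lt_one (by positivity)]
    linarith
  have hEx : ∀ x : ℝ, E x ∈ U := fun x => by
    obtain ⟨y, hy, hxy⟩ := hEreal x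
    rw [hxy]
    exact hQ y hy
  have hdx : ∀ x : ℝ, 1 + Complex.exp x ≠ 0 := fun x => by
    rw [← Complex.ofReal_exp]
    have : (0 : ℝ) < 1 + Real.exp x := by positivity
    exact_mod_cast this.ne'
  have hLreal : ∀ x : ℝ, L (E x) = x := by
    have hcont : Continuous fun x : ℝ => L (E x) := by
      have : Continuous fun x : ℝ => E x := continuous_iff_continuousAt.2 fun x =>
        ContinuousAt.comp (f := Complex.ofReal) (g := E) (hEc _ (hdx x))
          Complex.continuous_ofReal.continuousAt
      exact hL.comp_continuous this hEx
    have := Complex.eq_of_exp_comp_eq hcont Complex.continuous_ofReal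
      (fun x => by rw [hexp _ (hEx x), hexpE _ (hdx x)]) (a := 0) (by
        have : E ((0 : ℝ) : ℂ) = ((1 / 2 : ℝ) : ℂ) := by simp [E]; norm_num
        rw [this, hLdef]
        simp)
    exact fun x => congrFun this x
  have hR : ∀ x : ℝ, (x : ℂ) ∈ L '' U := fun x => ⟨E x, hEx x, hLreal x⟩
  have him : ∀ z ∈ U, (L z).im = 0 ↔ z ∈ Complex.ofReal '' Icc (0 : ℝ) 1 := fun z hz => by
    constructor
    · intro h
      obtain ⟨y, hy, hxy⟩ := hEreal (L z).re
      have : L z = ((L z).re : ℂ) := Complex.ext (by simp) (by simp [h])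
      rw [← this, hEL hz] at hxy
      exact ⟨y, Ioo_subset_Icc_self hy, hxy.symm⟩
    · rintro ⟨y, hy, rfl⟩
      have hy0 : y ≠ 0 := fun h => hne0 _ hz (by simp [h])
      have hy1 : y ≠ 1 := fun h => hne1 _ hz (by simp [h])
      have hy' : 0 < y / (1 - y) :=
        div_pos (lt_of_le_of_ne hy.1 hy0.symm) (sub_pos.2 (lt_of_le_of_ne hy.2 hy1))
      have hey : Complex.exp (Real.log (y / (1 - y)) : ℝ) = (y : ℂ) / (1 - y) := by
        rw [← Complex.ofReal_exp, Real.exp_log hy']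
        push_cast
        rfl
      have h2 : E (Real.log (y / (1 - y)) : ℝ) = (y : ℂ) := by
        have := hEL hz
        simp only [E] at this ⊢
        rw [hexp _ hz] at this
        rw [hey, this]
      rw [← h2, hLreal]
      simp
  refine ⟨U ∩ {z | 0 < (L z).im}, U ∩ {z | 0 < (-L z).im}, ?_, ?_, ?_, ?_, ?_, ?_⟩
  · exact (Complex.continuous_im.comp_continuousOn hL).isOpen_inter_preimage hUo isOpen_Ioi
  · exact (Complex.continuous_im.comp_continuousOn hL.neg).isOpen_inter_preimage hUo isOpen_Ioi
  · rw [Set.disjoint_left]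
    rintro z ⟨-, hz⟩ ⟨-, hz'⟩
    simp only [mem_ofPred_eq, Complex.neg_im] at hz hz'
    linarith
  · rw [← inter_union_distrib_left]
    ext z
    refine and_congr_right fun hz => ?_
    rw [← him z hz]
    simp only [mem_union, mem_ofPred_eq, Complex.neg_im, Left.neg_pos_iff]
    rw [or_comm, lt_or_lt_iff_ne]
  · exact hU.inter_im_comp_pos hL
      (fun w hw => (hEc w (hEd w hw)).continuousWithinAt) hEL ho hR
  · have himg : (fun z => -L z) '' U = -(L '' U) := by
      rw [← image_neg_eq_neg, image_image]
    refine hU.inter_im_comp_pos (L := fun z => -L z) (E := fun w => E (-w)) hL.neg ?_ ?_ ?_ ?_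
    · rw [himg]
      intro w hw
      exact (ContinuousAt.comp (f := Neg.neg) (g := E) (hEc (-w) (hEd (-w) hw))
        continuousAt_neg).continuousWithinAt
    · intro z hz
      simp only [neg_neg]
      exact hEL hz
    · rw [himg]
      exact ho.neg
    · intro x
      rw [himg, Set.mem_neg]
      exact_mod_cast hR (-x)

/-- Removing from an open simply connected set a slit growing from a boundary point leaves a
simply connected set. -/
theorem IsSimplyConnected.diff_slit {U : Set ℂ} (hU : IsSimplyConnected U) (h0 : (0 : ℂ) ∉ U)
    (hcone : ∀ z : ℂ, 0 < z.re → z.re ≤ 3 / 2 → 2 * |z.im| < z.re → z ∈ U) :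
    IsSimplyConnected (U \ (Complex.ofReal '' Icc 0 1)) := by
  let s : ℂ → ℝ := fun z => max 0 (z.re - 2 * |z.im|) / (|z.re| + 2 * |z.im|)
  have hs1 : ∀ z, s z ≤ 1 := fun z => by
    refine div_le_one_of_le₀ (max_le (by positivity) ?_) (by positivity)
    linarith [le_abs_self z.re, abs_nonneg z.im]
  have hs0 : ∀ z, 0 ≤ s z := fun z => by positivity
  have hspos : ∀ z, 0 < s z → 2 * |z.im| < z.re := fun z h => by
    by_contra! hle
    simp only [s, max_eq_left (sub_nonpos.2 hle), zero_div, lt_irrefl] at h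
  have hsreal : ∀ z : ℂ, z.im = 0 → 0 < z.re → s z = 1 := fun z h h' => by
    simp [s, h, abs_of_pos h', max_eq_right h'.le, h'.ne']
  let τ : ℂ → ℝ := fun z => z.re + s z * max 0 (3 / 2 - z.re)
  have hτ : ∀ z, z.re ≤ τ z := fun z =>
    le_add_of_nonneg_right (mul_nonneg (hs0 z) (le_max_left _ _))
  have hsc : ContinuousOn s U := by
    refine ContinuousOn.div (by fun_prop) (by fun_prop) fun z hz h => h0 ?_
    have h1 : |z.re| = 0 := by linarith [abs_nonneg z.re, abs_nonneg z.im]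
    have h2 : |z.im| = 0 := by linarith [abs_nonneg z.re, abs_nonneg z.im]
    rwa [← show z = 0 from Complex.ext (abs_eq_zero.1 h1) (abs_eq_zero.1 h2)]
  have hτc : ContinuousOn τ U :=
    Complex.continuous_re.continuousOn.add (hsc.mul (by fun_prop))
  have hmove : ∀ z ∈ U, ∀ x : ℝ, z.re ≤ x → x ≤ τ z → (⟨x, z.im⟩ : ℂ) ∈ U := by
    intro z hz x h1 h2
    rcases eq_or_lt_of_le h1 with h | h
    · rwa [← h]
    · have h3 : 0 < s z * max 0 (3 / 2 - z.re) := by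
        have : x ≤ z.re + s z * max 0 (3 / 2 - z.re) := h2
        linarith
      have hs : 0 < s z := pos_of_mul_pos_left h3 (le_max_left _ _)
      have hm : 0 < 3 / 2 - z.re := by
        by_contra! hle
        simp [max_eq_left hle] at h3
      have hx : x ≤ 3 / 2 := by
        have : x ≤ z.re + s z * max 0 (3 / 2 - z.re) := h2
        rw [max_eq_right hm.le] at this
        nlinarith [hs1 z]
      have := hspos z hs
      have := abs_nonneg z.im
      exact hcone _ (by simp only; linarith) hx (by simp only; linarith)
  have hslit : ∀ w : ℂ, w ∈ Complex.ofReal '' Icc (0 : ℝ) 1 ↔ w.im = 0 ∧ 0 ≤ w.re ∧ w.re ≤ 1 := by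
    intro w
    constructor
    · rintro ⟨x, hx, rfl⟩
      exact ⟨by simp, hx.1, hx.2⟩
    · rintro ⟨h1, h2, h3⟩
      exact ⟨w.re, ⟨h2, h3⟩, Complex.ext (by simp) (by simp [h1])⟩
  refine hU.of_segment_subset (i := id) (r := fun z => ⟨τ z, z.im⟩) continuousOn_id ?_
    (fun z hz => hz.1) (fun z hz => ⟨hmove z hz _ (hτ z) le_rfl, ?_⟩) (fun z hz => ?_)
  · exact Complex.equivRealProdCLM.symm.continuous.comp_continuousOn
      (hτc.prodMk Complex.continuous_im.continuousOn)
  · rw [hslit]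
    rintro ⟨h1, h2, h3⟩
    simp only at h1 h2 h3
    rcases lt_trichotomy z.re 0 with h | h | h
    · have hs : s z = 0 := by simp [s, h1, max_eq_left h.le]
      simp only [τ, hs] at h2
      linarith
    · exact h0 (by rwa [show z = 0 from Complex.ext h h1] at hz)
    · simp only [τ, hsreal z h1 h] at h3
      linarith [le_max_right 0 (3 / 2 - z.re)]
  · rintro w ⟨a, b, ha, hb, hab, rfl⟩
    have hw : a • z + b • (⟨τ z, z.im⟩ : ℂ) = ⟨a * z.re + b * τ z, z.im⟩ :=
      Complex.ext (by simp) (by simp [← add_mul, hab])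
    obtain rfl : a = 1 - b := by linarith
    have hle : z.re ≤ (1 - b) * z.re + b * τ z := by
      nlinarith [mul_nonneg hb (sub_nonneg.2 (hτ z))]
    simp only [id]
    rw [hw]
    refine ⟨hmove z hz.1 _ hle (by
      nlinarith [mul_nonneg ha (sub_nonneg.2 (hτ z))]), ?_⟩
    rw [hslit]
    rintro ⟨h1, h2, h3⟩
    simp only at h1 h2 h3
    have hzs := hz.2
    rw [hslit] at hzs
    have hzneg : z.re < 0 := by
      by_contra! h
      exact hzs ⟨h1, h, hle.trans h3⟩
    have hs : s z = 0 := by simp [s, h1, max_eq_left hzneg.le]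
    simp only [τ, hs] at h2
    nlinarith

/-- A set all of whose points lie in an open simply connected piece which is relatively clopen. -/
def HasSimplyConnectedPieces (V : Set ℂ) : Prop :=
  ∀ x ∈ V, ∃ W ⊆ V, x ∈ W ∧ IsOpen W ∧ IsOpen (V \ W) ∧ IsSimplyConnected W

namespace HasSimplyConnectedPieces

variable {V : Set ℂ}

theorem isOpen (hV : HasSimplyConnectedPieces V) : IsOpen V := by
  rw [isOpen_iff_mem_nhds]
  intro x hx
  obtain ⟨W, hWV, hxW, hWo, -⟩ := hV x hx
  exact mem_of_superset (hWo.mem_nhds hxW) hWV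

theorem simplyConnectedSpace_connectedComponentIn (hV : HasSimplyConnectedPieces V) {x : ℂ}
    (hx : x ∈ V) : SimplyConnectedSpace (connectedComponentIn V x) := by
  obtain ⟨W, hWV, hxW, hWo, hVW, hW⟩ := hV x hx
  have : connectedComponentIn V x = W := by
    refine Subset.antisymm ?_
      (hW.isPathConnected.isConnected.isPreconnected.subset_connectedComponentIn hxW hWV)
    refine isPreconnected_connectedComponentIn.subset_left_of_subset_union hWo hVW
      disjoint_sdiff_right ?_ ⟨x, mem_connectedComponentIn hx, hxW⟩
    rw [union_sdiff_cancel hWV]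
    exact connectedComponentIn_subset V x
  rw [this]
  exact hW.simplyConnectedSpace

theorem preimage (hV : HasSimplyConnectedPieces V) (e : ℂ ≃ₜ ℂ) :
    HasSimplyConnectedPieces (e ⁻¹' V) := by
  intro x hx
  obtain ⟨W, hWV, hxW, hWo, hVW, hW⟩ := hV (e x) hx
  exact ⟨e ⁻¹' W, preimage_mono hWV, hxW, hWo.preimage e.continuous,
    hVW.preimage e.continuous, e.isSimplyConnected_preimage.2 hW⟩

/-- The union of the pieces meeting a given set. -/
theorem exists_subset_meeting (hV : HasSimplyConnectedPieces V) {K : Set ℂ} (hK : K ⊆ V) :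
    ∃ V' ⊆ V, K ⊆ V' ∧ HasSimplyConnectedPieces V' ∧
      ∀ x ∈ V', ∃ W ⊆ V, x ∈ W ∧ IsPreconnected W ∧ (W ∩ K).Nonempty := by
  let p : Set ℂ → Prop := fun W =>
    W ⊆ V ∧ IsOpen W ∧ IsOpen (V \ W) ∧ IsSimplyConnected W ∧ (W ∩ K).Nonempty
  refine ⟨⋃₀ {W | p W}, sUnion_subset fun W hW => hW.1, fun k hk => ?_, ?_, ?_⟩
  · obtain ⟨W, hWV, hxW, hWo, hVW, hW⟩ := hV k (hK hk)
    exact ⟨W, ⟨hWV, hWo, hVW, hW, k, hxW, hk⟩, hxW⟩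
  · rintro x ⟨W, hW, hxW⟩
    refine ⟨W, subset_sUnion_of_mem hW, hxW, hW.2.1, ?_, hW.2.2.2.1⟩
    have : ⋃₀ {W | p W} \ W = (⋃₀ {W | p W}) ∩ (V \ W) := by
      ext z
      exact ⟨fun h => ⟨h.1, sUnion_subset (fun W hW => hW.1) h.1, h.2⟩, fun h => ⟨h.1, h.2.2⟩⟩
    rw [this]
    exact (isOpen_sUnion fun W hW => hW.2.1).inter hW.2.2.1
  · rintro x ⟨W, hW, hxW⟩
    exact ⟨W, hW.1, hxW, hW.2.2.2.1.isPathConnected.isConnected.isPreconnected, hW.2.2.2.2⟩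

theorem diff_crosscut (hV : HasSimplyConnectedPieces V) (h0 : (0 : ℂ) ∉ V) (h1 : (1 : ℂ) ∉ V)
    (hQ : ∀ x ∈ Ioo (0 : ℝ) 1, (x : ℂ) ∈ V) :
    HasSimplyConnectedPieces (V \ (Complex.ofReal '' Icc 0 1)) := by
  have hQc : IsClosed (Complex.ofReal '' Icc (0 : ℝ) 1) :=
    (isCompact_Icc.image Complex.continuous_ofReal).isClosed
  rintro x ⟨hx, hxQ⟩
  obtain ⟨W, hWV, hxW, hWo, hVW, hW⟩ := hV x hx
  by_cases hQW : ∀ x ∈ Ioo (0 : ℝ) 1, (x : ℂ) ∈ W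
  · obtain ⟨P, N, hP, hN, hPN, hU, hPs, hNs⟩ := hW.exists_diff_crosscut hWo
      (fun h => h0 (hWV h)) (fun h => h1 (hWV h)) hQW
    have key : ∀ P N : Set ℂ, IsOpen P → IsOpen N → Disjoint P N →
        P ∪ N = W \ (Complex.ofReal '' Icc 0 1) → IsSimplyConnected P → x ∈ P →
        ∃ W' ⊆ V \ (Complex.ofReal '' Icc 0 1), x ∈ W' ∧ IsOpen W' ∧
          IsOpen ((V \ (Complex.ofReal '' Icc 0 1)) \ W') ∧ IsSimplyConnected W' := by
      intro P N hP hN hPN hU hPs hxP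
      have hsub : P ∪ N ⊆ V \ (Complex.ofReal '' Icc 0 1) :=
        hU ▸ sdiff_subset_sdiff_left hWV
      refine ⟨P, subset_union_left.trans hsub, hxP, hP, ?_, hPs⟩
      have : (V \ (Complex.ofReal '' Icc 0 1)) \ P =
          ((V \ W) \ (Complex.ofReal '' Icc 0 1)) ∪ N := by
        ext z
        have hz : z ∈ P ∨ z ∈ N ↔ z ∈ W ∧ z ∉ Complex.ofReal '' Icc (0 : ℝ) 1 := by
          rw [← mem_union, hU]; rfl
        have hzd : z ∈ P → z ∉ N := fun h h' => Set.disjoint_left.1 hPN h h'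
        have hzV : z ∈ W → z ∈ V := fun h => hWV h
        simp only [mem_union, Set.mem_sdiff]
        tauto
      rw [this]
      exact (hVW.sdiff hQc).union hN
    have hxPN : x ∈ P ∪ N := hU ▸ ⟨hxW, hxQ⟩
    rcases hxPN with hxP | hxN
    · exact key P N hP hN hPN hU hPs hxP
    · exact key N P hN hP hPN.symm (by rw [union_comm, hU]) hNs hxN
  · have hdisj : ∀ y ∈ Ioo (0 : ℝ) 1, (y : ℂ) ∉ W := by
      intro y hy hyW
      refine hQW fun t ht => ?_
      have hpre : IsPreconnected (Complex.ofReal '' Ioo (0 : ℝ) 1) :=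
        isPreconnected_Ioo.image _ Complex.continuous_ofReal.continuousOn
      refine hpre.subset_left_of_subset_union hWo hVW disjoint_sdiff_right ?_
        ⟨y, mem_image_of_mem _ hy, hyW⟩ (mem_image_of_mem _ ht)
      rw [union_sdiff_cancel hWV]
      rintro _ ⟨s, hs, rfl⟩
      exact hQ s hs
    refine ⟨W, fun z hz => ⟨hWV hz, ?_⟩, hxW, hWo, ?_, hW⟩
    · rintro ⟨y, hy, rfl⟩
      rcases eq_or_lt_of_le hy.1 with h | h
      · exact h0 (hWV (by simpa [← h] using hz))
      rcases eq_or_lt_of_le hy.2 with h' | h'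
      · exact h1 (hWV (by simpa [h'] using hz))
      exact hdisj y ⟨h, h'⟩ hz
    · rw [sdiff_right_comm]
      exact hVW.sdiff hQc

theorem diff_slit (hV : HasSimplyConnectedPieces V) (h0 : (0 : ℂ) ∉ V)
    (hcone : ∀ z : ℂ, 0 < z.re → z.re ≤ 3 / 2 → 2 * |z.im| < z.re → z ∈ V) :
    HasSimplyConnectedPieces (V \ (Complex.ofReal '' Icc 0 1)) := by
  have hQc : IsClosed (Complex.ofReal '' Icc (0 : ℝ) 1) :=
    (isCompact_Icc.image Complex.continuous_ofReal).isClosed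
  let T : Set ℂ := {z | 0 < z.re ∧ z.re ≤ 3 / 2 ∧ 2 * |z.im| < z.re}
  have hT : IsPreconnected T := by
    have : Convex ℝ T := by
      rintro z ⟨hz1, hz2, hz3⟩ w ⟨hw1, hw2, hw3⟩ a b ha hb hab
      obtain rfl : a = 1 - b := by linarith
      rw [← lt_div_iff₀' two_pos, abs_lt] at hz3 hw3
      have hre : ((1 - b) • z + b • w).re = (1 - b) * z.re + b * w.re := by simp
      have him : ((1 - b) • z + b • w).im = (1 - b) * z.im + b * w.im := by simp
      change 0 < ((1 - b) • z + b • w).re ∧ ((1 - b) • z + b • w).re ≤ 3 / 2 ∧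
        2 * |((1 - b) • z + b • w).im| < ((1 - b) • z + b • w).re
      rw [← lt_div_iff₀' two_pos, abs_lt, hre, him]
      rcases eq_or_lt_of_le hb with h | h
      · simp only [← h, sub_zero, one_mul, zero_mul, add_zero]
        exact ⟨hz1, hz2, hz3⟩
      · refine ⟨?_, ?_, ?_, ?_⟩ <;> nlinarith
    exact this.isPreconnected
  have hTV : T ⊆ V := fun z hz => hcone z hz.1 hz.2.1 hz.2.2
  have hQT : ∀ y ∈ Icc (0 : ℝ) 1, (y : ℂ) ≠ 0 → (y : ℂ) ∈ T := fun y hy hy0 => by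
    have : 0 < y := lt_of_le_of_ne hy.1 (fun h => hy0 (by simp [← h]))
    exact ⟨by simpa, by simp; linarith [hy.2], by simpa⟩
  rintro x ⟨hx, hxQ⟩
  obtain ⟨W, hWV, hxW, hWo, hVW, hW⟩ := hV x hx
  by_cases hTW : T ⊆ W
  · refine ⟨W \ (Complex.ofReal '' Icc 0 1), sdiff_subset_sdiff_left hWV, ⟨hxW, hxQ⟩,
      hWo.sdiff hQc, ?_, hW.diff_slit (fun h => h0 (hWV h)) fun z h1 h2 h3 => hTW ⟨h1, h2, h3⟩⟩
    have : (V \ (Complex.ofReal '' Icc 0 1)) \ (W \ (Complex.ofReal '' Icc 0 1)) =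
        (V \ W) \ (Complex.ofReal '' Icc 0 1) := by
      ext z
      simp only [Set.mem_sdiff]
      tauto
    rw [this]
    exact hVW.sdiff hQc
  · refine ⟨W, fun z hz => ⟨hWV hz, ?_⟩, hxW, hWo, ?_, hW⟩
    · rintro ⟨y, hy, rfl⟩
      refine hTW (hT.subset_left_of_subset_union hWo hVW disjoint_sdiff_right ?_
        ⟨y, hQT y hy fun h => h0 (h ▸ hWV hz), hz⟩)
      rwa [union_sdiff_cancel hWV]
    · rw [sdiff_right_comm]
      exact hVW.sdiff hQc

end HasSimplyConnectedPieces

/-- Unions of closed faces of the unit grid. -/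
def IsGridSet (F : Set ℂ) : Prop :=
  ∀ z ∈ F, ∀ w : ℂ, (⌊z.re⌋ : ℝ) ≤ w.re → w.re ≤ ⌈z.re⌉ → (⌊z.im⌋ : ℝ) ≤ w.im → w.im ≤ ⌈z.im⌉ →
    w ∈ F

/-- The closed rectangle with lower left corner `(a, c)` and upper right corner `(b, d)`. -/
def gridBox (a b c d : ℤ) : Set ℂ :=
  {z | (a : ℝ) ≤ z.re ∧ z.re ≤ b ∧ (c : ℝ) ≤ z.im ∧ z.im ≤ d}

theorem isGridSet_gridBox (a b c d : ℤ) : IsGridSet (gridBox a b c d) := by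
  rintro z ⟨h1, h2, h3, h4⟩ w g1 g2 g3 g4
  have h1' : (a : ℝ) ≤ ⌊z.re⌋ := by exact_mod_cast Int.le_floor.2 h1
  have h2' : (⌈z.re⌉ : ℝ) ≤ b := by exact_mod_cast Int.ceil_le.2 h2
  have h3' : (c : ℝ) ≤ ⌊z.im⌋ := by exact_mod_cast Int.le_floor.2 h3
  have h4' : (⌈z.im⌉ : ℝ) ≤ d := by exact_mod_cast Int.ceil_le.2 h4
  exact ⟨by linarith, by linarith, by linarith, by linarith⟩

/-- The open square of half side `M` centered at the origin. -/
def openSquare (M : ℤ) : Set ℂ := {z | |z.re| < M ∧ |z.im| < M}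

theorem isGridSet_compl_openSquare (M : ℤ) : IsGridSet (openSquare M)ᶜ := by
  intro z hz w g1 g2 g3 g4 hw
  refine hz ?_
  obtain ⟨hw1, hw2⟩ := hw
  rw [abs_lt] at hw1 hw2
  have a1 : -M < ⌈z.re⌉ := by exact_mod_cast hw1.1.trans_le g2
  have a2 : ⌊z.re⌋ < M := by exact_mod_cast g1.trans_lt hw1.2
  have a3 : -M < ⌈z.im⌉ := by exact_mod_cast hw2.1.trans_le g4
  have a4 : ⌊z.im⌋ < M := by exact_mod_cast g3.trans_lt hw2.2
  rw [Int.lt_ceil] at a1 a3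
  rw [Int.floor_lt] at a2 a4
  push_cast at a1 a3
  exact ⟨abs_lt.2 ⟨a1, a2⟩, abs_lt.2 ⟨a3, a4⟩⟩

theorem hasSimplyConnectedPieces_openSquare {M : ℤ} (hM : 0 < M) :
    HasSimplyConnectedPieces (openSquare M) := by
  have ho : IsOpen (openSquare M) := by
    have h1 : IsOpen {z : ℂ | |z.re| < (M : ℝ)} := isOpen_lt (by fun_prop) continuous_const
    have h2 : IsOpen {z : ℂ | |z.im| < (M : ℝ)} := isOpen_lt (by fun_prop) continuous_const
    exact h1.inter h2
  have hc : Convex ℝ (openSquare M) := by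
    have h1 : Convex ℝ (Complex.reLm ⁻¹' Ioo (-M : ℝ) M) :=
      (convex_Ioo _ _).linear_preimage Complex.reLm
    have h2 : Convex ℝ (Complex.imLm ⁻¹' Ioo (-M : ℝ) M) :=
      (convex_Ioo _ _).linear_preimage Complex.imLm
    convert h1.inter h2 using 1
    ext z
    simp [openSquare, abs_lt]
  have hne : (openSquare M).Nonempty := ⟨0, by simp [openSquare, hM]⟩
  have hs : IsSimplyConnected (openSquare M) := by
    have := hc.contractibleSpace hne
    exact SimplyConnectedSpace.ofContractible _
  intro x hx
  exact ⟨openSquare M, Subset.rfl, hx, ho, by simp, hs⟩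

namespace IsGridSet

variable {F G : Set ℂ}

theorem union (hF : IsGridSet F) (hG : IsGridSet G) : IsGridSet (F ∪ G) := by
  rintro z (hz | hz) w g1 g2 g3 g4
  · exact Or.inl (hF z hz w g1 g2 g3 g4)
  · exact Or.inr (hG z hz w g1 g2 g3 g4)

theorem preimage_add (hF : IsGridSet F) (m n : ℤ) :
    IsGridSet ((fun z : ℂ => z + ⟨m, n⟩) ⁻¹' F) := by
  intro z hz w g1 g2 g3 g4
  refine hF _ hz _ ?_ ?_ ?_ ?_ <;> simpa

theorem preimage_I_mul (hF : IsGridSet F) : IsGridSet ((fun z : ℂ => Complex.I * z) ⁻¹' F) := by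
  intro z hz w g1 g2 g3 g4
  refine hF _ hz _ ?_ ?_ ?_ ?_ <;> simpa [Int.floor_neg, Int.ceil_neg]

theorem preimage_I_pow_mul (hF : IsGridSet F) (k : ℕ) :
    IsGridSet ((fun z : ℂ => Complex.I ^ k * z) ⁻¹' F) := by
  induction k with
  | zero => simpa using hF
  | succ k ih =>
    convert ih.preimage_I_mul using 1
    ext z
    simp [pow_succ, mul_assoc]

theorem diff_unit_segment (hF : IsGridSet F) (hV : HasSimplyConnectedPieces Fᶜ)
    (h0 : (0 : ℂ) ∈ F) (hsub : ¬ Complex.ofReal '' Icc 0 1 ⊆ F) :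
    HasSimplyConnectedPieces (Fᶜ \ (Complex.ofReal '' Icc 0 1)) := by
  have hIoo : ∀ x ∈ Ioo (0 : ℝ) 1, (x : ℂ) ∉ F := by
    intro x hx hxF
    refine hsub ?_
    rintro _ ⟨y, hy, rfl⟩
    have h1 : ⌊x⌋ = 0 := Int.floor_eq_zero_iff.2 ⟨hx.1.le, hx.2⟩
    have h2 : ⌈x⌉ = 1 := Int.ceil_eq_iff.2 ⟨by simpa using hx.1, by simpa using hx.2.le⟩
    exact hF _ hxF _ (by simpa [h1] using hy.1) (by simpa [h2] using hy.2) (by simp) (by simp)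
  by_cases h1 : (1 : ℂ) ∈ F
  · exact hV.diff_crosscut (not_not.2 h0) (not_not.2 h1) hIoo
  · refine hV.diff_slit (not_not.2 h0) fun z hz1 hz2 hz3 hzF => ?_
    have him : |z.im| < 1 := by linarith
    rw [abs_lt] at him
    have hfl : (⌊z.im⌋ : ℝ) ≤ 0 := by
      exact_mod_cast Int.lt_add_one_iff.1 (Int.floor_lt.2 (by simpa using him.2))
    have hce : (0 : ℝ) ≤ ⌈z.im⌉ := by
      have : (-1 : ℤ) < ⌈z.im⌉ := Int.lt_ceil.2 (by simpa using him.1)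
      exact_mod_cast this
    rcases lt_or_ge z.re 1 with h | h
    · exact hIoo z.re ⟨hz1, h⟩ (hF z hzF _ (by simpa using Int.floor_le _)
        (by simpa using Int.le_ceil _) (by simpa using hfl) (by simpa using hce))
    · have : ⌊z.re⌋ = 1 := Int.floor_eq_iff.2 ⟨by simpa using h, by norm_num; linarith⟩
      exact h1 (hF z hzF _ (by simp [this]) (by simpa using h.trans (Int.le_ceil _))
        (by simpa using hfl) (by simpa using hce))

/-- Adding to a grid set an edge with an endpoint in this set preserves the property that the
complement has simply connected pieces. -/
theorem compl_union_edge (hF : IsGridSet F) (hV : HasSimplyConnectedPieces Fᶜ) (m n : ℤ) (k : ℕ)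
    (h0 : (⟨m, n⟩ : ℂ) ∈ F)
    (hsub : ¬ (fun t : ℝ => Complex.I ^ k * t + ⟨m, n⟩) '' Icc 0 1 ⊆ F) :
    HasSimplyConnectedPieces (F ∪ (fun t : ℝ => Complex.I ^ k * t + ⟨m, n⟩) '' Icc 0 1)ᶜ := by
  let e : ℂ ≃ₜ ℂ := (Homeomorph.mulLeft₀ (Complex.I ^ k) (pow_ne_zero k Complex.I_ne_zero)).trans
    (Homeomorph.addRight (⟨m, n⟩ : ℂ))
  have he : ∀ z, e z = Complex.I ^ k * z + ⟨m, n⟩ := fun z => rfl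
  have himg : (fun t : ℝ => Complex.I ^ k * t + (⟨m, n⟩ : ℂ)) '' Icc 0 1 =
      e '' (Complex.ofReal '' Icc 0 1) := by
    rw [image_image]
    rfl
  have hgrid : IsGridSet (e ⁻¹' F) := (hF.preimage_add m n).preimage_I_pow_mul k
  rw [himg] at hsub ⊢
  have := (hgrid.diff_unit_segment (by rw [← preimage_compl]; exact hV.preimage e)
    (by rw [mem_preimage, he]; simpa using h0)
    (by rwa [← image_subset_iff])).preimage e.symm
  convert this using 1
  rw [compl_union, preimage_sdiff, ← preimage_compl, ← e.image_eq_preimage_symm,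
    e.image_preimage, e.image_eq_preimage_symm (Complex.ofReal '' Icc 0 1), sdiff_eq]

end IsGridSet

theorem image_I_pow_zero (m n : ℤ) :
    (fun t : ℝ => Complex.I ^ 0 * t + (⟨m, n⟩ : ℂ)) '' Icc 0 1 = gridBox m (m + 1) n n := by
  ext z
  constructor
  · rintro ⟨t, ht, rfl⟩
    simp [gridBox]
    exact ⟨ht.1, by linarith [ht.2]⟩
  · rintro ⟨h1, h2, h3, h4⟩
    push_cast at h2
    exact ⟨z.re - m, ⟨by linarith, by linarith⟩,
      Complex.ext (by simp) (by simpa using le_antisymm h3 h4)⟩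

theorem image_I_pow_one (m n : ℤ) :
    (fun t : ℝ => Complex.I ^ 1 * t + (⟨m, n⟩ : ℂ)) '' Icc 0 1 = gridBox m m n (n + 1) := by
  ext z
  constructor
  · rintro ⟨t, ht, rfl⟩
    simp [gridBox]
    exact ⟨ht.1, by linarith [ht.2]⟩
  · rintro ⟨h1, h2, h3, h4⟩
    push_cast at h4
    exact ⟨z.im - n, ⟨by linarith, by linarith⟩,
      Complex.ext (by simpa using le_antisymm h1 h2) (by simp)⟩

theorem image_I_pow_two (m n : ℤ) :
    (fun t : ℝ => Complex.I ^ 2 * t + (⟨(m + 1 : ℤ), n⟩ : ℂ)) '' Icc 0 1 =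
      gridBox m (m + 1) n n := by
  ext z
  constructor
  · rintro ⟨t, ht, rfl⟩
    simp only [gridBox, Complex.I_sq, mem_ofPred_eq]
    simp
    exact ⟨by linarith [ht.2], ht.1⟩
  · rintro ⟨h1, h2, h3, h4⟩
    push_cast at h2
    exact ⟨m + 1 - z.re, ⟨by linarith, by linarith⟩,
      Complex.ext (by simp [Complex.I_sq]) (by simpa [Complex.I_sq] using le_antisymm h3 h4)⟩

theorem image_I_pow_three (m n : ℤ) :
    (fun t : ℝ => Complex.I ^ 3 * t + (⟨m, (n + 1 : ℤ)⟩ : ℂ)) '' Icc 0 1 =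
      gridBox m m n (n + 1) := by
  ext z
  constructor
  · rintro ⟨t, ht, rfl⟩
    simp only [gridBox, Complex.I_pow_three, mem_ofPred_eq]
    simp
    exact ⟨by linarith [ht.2], ht.1⟩
  · rintro ⟨h1, h2, h3, h4⟩
    push_cast at h4
    exact ⟨n + 1 - z.im, ⟨by linarith, by linarith⟩,
      Complex.ext (by simpa [Complex.I_pow_three] using le_antisymm h1 h2)
        (by simp [Complex.I_pow_three])⟩

/-- The edge of the unit grid starting at `(m, n)`, horizontal or vertical according to `b`. -/
def gridEdge (e : ℤ × ℤ × Bool) : Set ℂ :=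
  if e.2.2 then gridBox e.1 (e.1 + 1) e.2.1 e.2.1 else gridBox e.1 e.1 e.2.1 (e.2.1 + 1)

/-- The terminal vertex of an edge of the unit grid. -/
def gridEdgeEnd (e : ℤ × ℤ × Bool) : ℂ :=
  if e.2.2 then ⟨(e.1 + 1 : ℤ), e.2.1⟩ else ⟨e.1, (e.2.1 + 1 : ℤ)⟩

theorem isGridSet_gridEdge (e : ℤ × ℤ × Bool) : IsGridSet (gridEdge e) := by
  unfold gridEdge
  split_ifs <;> exact isGridSet_gridBox _ _ _ _

theorem IsGridSet.compl_union_gridEdge {F : Set ℂ} (hF : IsGridSet F)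
    (hV : HasSimplyConnectedPieces Fᶜ) (e : ℤ × ℤ × Bool)
    (h0 : (⟨e.1, e.2.1⟩ : ℂ) ∈ F ∨ gridEdgeEnd e ∈ F) (hsub : ¬ gridEdge e ⊆ F) :
    HasSimplyConnectedPieces (F ∪ gridEdge e)ᶜ := by
  obtain ⟨m, n, b⟩ := e
  cases b
  · simp only [gridEdge, gridEdgeEnd, Bool.false_eq_true, if_false] at h0 hsub ⊢
    rcases h0 with h0 | h0
    · rw [← image_I_pow_one] at hsub ⊢
      exact hF.compl_union_edge hV m n 1 h0 hsub
    · rw [← image_I_pow_three] at hsub ⊢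
      exact hF.compl_union_edge hV m (n + 1) 3 h0 hsub
  · simp only [gridEdge, gridEdgeEnd, if_true] at h0 hsub ⊢
    rcases h0 with h0 | h0
    · rw [← image_I_pow_zero] at hsub ⊢
      exact hF.compl_union_edge hV m n 0 h0 hsub
    · rw [← image_I_pow_two] at hsub ⊢
      exact hF.compl_union_edge hV (m + 1) n 2 h0 hsub

/-- There is a grid set containing the complement of a given square, disjoint from `K`, closed
under adding edges which do not meet `K`, and whose complement has simply connected pieces. -/
theorem exists_gridSet_saturated {K : Set ℂ} {M : ℤ} (hM : 0 < M) (hK : K ⊆ openSquare M) :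
    ∃ F : Set ℂ, IsGridSet F ∧ (openSquare M)ᶜ ⊆ F ∧ Disjoint F K ∧
      HasSimplyConnectedPieces Fᶜ ∧ ∀ e, Disjoint (gridEdge e) K →
        (⟨e.1, e.2.1⟩ : ℂ) ∈ F ∨ gridEdgeEnd e ∈ F → gridEdge e ⊆ F := by
  classical
  let T : Finset (ℤ × ℤ × Bool) := Finset.Icc (-M) M ×ˢ Finset.Icc (-M) M ×ˢ Finset.univ
  have hT : ∀ e ∉ T, gridEdge e ⊆ (openSquare M)ᶜ := by
    rintro ⟨m, n, b⟩ he z hz ⟨hz1, hz2⟩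
    refine he ?_
    rw [abs_lt] at hz1 hz2
    simp only [T, Finset.mem_product, Finset.mem_Icc, Finset.mem_univ, and_true]
    have hz' : (m : ℝ) ≤ z.re ∧ z.re ≤ m + 1 ∧ (n : ℝ) ≤ z.im ∧ z.im ≤ n + 1 := by
      cases b <;> simp [gridEdge, gridBox] at hz <;>
        exact ⟨by linarith, by linarith, by linarith, by linarith⟩
    obtain ⟨a1, a2, a3, a4⟩ := hz'
    have b1 : m < M := by exact_mod_cast a1.trans_lt hz1.2
    have b2 : -M < m + 1 := by exact_mod_cast hz1.1.trans_le a2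
    have b3 : n < M := by exact_mod_cast a3.trans_lt hz2.2
    have b4 : -M < n + 1 := by exact_mod_cast hz2.1.trans_le a4
    omega
  let p : Finset (ℤ × ℤ × Bool) → Set ℂ → Prop := fun E F => IsGridSet F ∧ (openSquare M)ᶜ ⊆ F ∧
    Disjoint F K ∧ HasSimplyConnectedPieces Fᶜ ∧ ∀ e ∈ E, gridEdge e ⊆ F
  obtain ⟨E, hE⟩ := (T.powerset.filter fun E => ∃ F, p E F).exists_maximal
    ⟨∅, Finset.mem_filter.2 ⟨Finset.empty_mem_powerset T, (openSquare M)ᶜ,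
      isGridSet_compl_openSquare M, Subset.rfl, disjoint_compl_left_iff_subset.2 hK,
      by rw [compl_compl]; exact hasSimplyConnectedPieces_openSquare hM, by simp⟩⟩
  obtain ⟨hET, F, hF1, hF2, hF3, hF4, hF5⟩ := Finset.mem_filter.1 hE.prop
  refine ⟨F, hF1, hF2, hF3, hF4, fun e heK he => ?_⟩
  by_contra hsub
  have heT : e ∈ T := by
    by_contra h
    exact hsub ((hT e h).trans hF2)
  have hins : insert e E ∈ T.powerset.filter fun E => ∃ F, p E F := by
    refine Finset.mem_filter.2 ⟨Finset.mem_powerset.2 (Finset.insert_subset heT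
      (Finset.mem_powerset.1 hET)), F ∪ gridEdge e, hF1.union (isGridSet_gridEdge e),
      hF2.trans subset_union_left, hF3.union_left heK, hF1.compl_union_gridEdge hF4 e he hsub, ?_⟩
    intro e' he'
    rcases Finset.mem_insert.1 he' with rfl | h
    · exact subset_union_right
    · exact (hF5 e' h).trans subset_union_left
  exact hsub (hF5 e (hE.le_of_ge hins (Finset.subset_insert e E) (Finset.mem_insert_self e E)))

/-- Far from `K`, a set saturated under adding edges contains with a vertex all its neighbors and
the edges joining them. -/
theorem mem_neighbor_vertex_iff {F K : Set ℂ}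
    (hF : ∀ e, Disjoint (gridEdge e) K →
      (⟨e.1, e.2.1⟩ : ℂ) ∈ F ∨ gridEdgeEnd e ∈ F → gridEdge e ⊆ F)
    {w : ℂ} (hw : ∀ k ∈ K, 10 < dist w k) {m n : ℤ} (hm : |m - w.re| ≤ 2) (hn : |n - w.im| ≤ 2) :
    ((⟨m, n⟩ : ℂ) ∈ F ↔ (⟨(m + 1 : ℤ), n⟩ : ℂ) ∈ F) ∧
      ((⟨m, n⟩ : ℂ) ∈ F ↔ (⟨m, (n + 1 : ℤ)⟩ : ℂ) ∈ F) ∧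
      ((⟨m, n⟩ : ℂ) ∈ F → gridBox m (m + 1) n n ⊆ F ∧ gridBox m m n (n + 1) ⊆ F) := by
  rw [abs_le] at hm hn
  have hdisj : ∀ b, Disjoint (gridEdge (m, n, b)) K := by
    refine fun b => disjoint_left.2 fun x hx hxK => ?_
    have hx' : (m : ℝ) ≤ x.re ∧ x.re ≤ m + 1 ∧ (n : ℝ) ≤ x.im ∧ x.im ≤ n + 1 := by
      cases b <;> simp [gridEdge, gridBox] at hx <;>
        exact ⟨by linarith, by linarith, by linarith, by linarith⟩
    obtain ⟨a1, a2, a3, a4⟩ := hx'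
    have h1 := hw x hxK
    have h2 := Complex.norm_le_abs_re_add_abs_im (w - x)
    have h3 : |(w - x).re| ≤ 3 := by
      rw [Complex.sub_re, abs_le]
      constructor <;> linarith
    have h4 : |(w - x).im| ≤ 3 := by
      rw [Complex.sub_im, abs_le]
      constructor <;> linarith
    rw [dist_eq_norm] at h1
    linarith
  have hh := hF _ (hdisj true)
  have hv := hF _ (hdisj false)
  simp only [gridEdge, gridEdgeEnd, if_true, Bool.false_eq_true, if_false] at hh hv
  refine ⟨⟨fun h => hh (Or.inl h) ?_, fun h => hh (Or.inr h) ?_⟩,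
    ⟨fun h => hv (Or.inl h) ?_, fun h => hv (Or.inr h) ?_⟩,
    fun h => ⟨hh (Or.inl h), hv (Or.inl h)⟩⟩ <;> simp [gridBox]

theorem exists_hasSimplyConnectedPieces_disjoint {K Z : Set ℂ} (hK : IsCompact K)
    (hZ : ∀ z ∈ Z, ∃ C : Set ℂ, z ∈ C ∧ IsPreconnected C ∧ ¬ Bornology.IsBounded C ∧
      ∀ w ∈ C, ∀ k ∈ K, 10 < dist w k) :
    ∃ V, K ⊆ V ∧ Disjoint V Z ∧ HasSimplyConnectedPieces V := by
  obtain ⟨R, hR⟩ := hK.isBounded.exists_norm_le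
  obtain ⟨M, hM0, hRM⟩ : ∃ M : ℤ, 0 < M ∧ R < M := by
    obtain ⟨M, hM⟩ := exists_nat_gt (max R 0)
    exact ⟨M, by exact_mod_cast (le_max_right R 0).trans_lt hM,
      by exact_mod_cast (le_max_left R 0).trans_lt hM⟩
  have hKM : K ⊆ openSquare M := fun k hk =>
    ⟨(Complex.abs_re_le_norm k).trans_lt ((hR k hk).trans_lt hRM),
      (Complex.abs_im_le_norm k).trans_lt ((hR k hk).trans_lt hRM)⟩
  obtain ⟨F, -, hF2, hF3, hF4, hF5⟩ := exists_gridSet_saturated hM0 hKM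
  obtain ⟨V, -, hKV, hV, hVK⟩ := hF4.exists_subset_meeting (disjoint_left.1 hF3.symm)
  refine ⟨V, hKV, disjoint_left.2 fun z hzV hzZ => ?_, hV⟩
  obtain ⟨C, hzC, hCc, hCb, hCK⟩ := hZ z hzZ
  have hzF : (⟨⌊z.re⌋, ⌊z.im⌋⟩ : ℂ) ∈ F := by
    have hconst : ∀ w ∈ C, ∀ x ∈ C,
        ((⟨⌊w.re⌋, ⌊w.im⌋⟩ : ℂ) ∈ F ↔ (⟨⌊x.re⌋, ⌊x.im⌋⟩ : ℂ) ∈ F) := by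
      intro w hw x hx
      refine hCc.induction₂ (fun w x => (⟨⌊w.re⌋, ⌊w.im⌋⟩ : ℂ) ∈ F ↔ (⟨⌊x.re⌋, ⌊x.im⌋⟩ : ℂ) ∈ F)
        ?_ (fun _ _ _ _ _ _ h1 h2 => h1.trans h2) (fun _ _ _ _ h => h.symm) hw hx
      intro w hw
      filter_upwards [mem_nhdsWithin_of_mem_nhds (Metric.ball_mem_nhds w one_pos)] with x hx
      rw [Metric.mem_ball, dist_eq_norm] at hx
      have hre := abs_lt.1 ((Complex.abs_re_le_norm _).trans_lt hx)
      have him := abs_lt.1 ((Complex.abs_im_le_norm _).trans_lt hx)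
      rw [Complex.sub_re] at hre
      rw [Complex.sub_im] at him
      have f1 := Int.floor_le w.re
      have f2 := Int.lt_floor_add_one w.re
      have f3 := Int.floor_le w.im
      have f4 := Int.lt_floor_add_one w.im
      have f5 := Int.floor_le x.re
      have f6 := Int.lt_floor_add_one x.re
      have f7 := Int.floor_le x.im
      have f8 := Int.lt_floor_add_one x.im
      have key := fun m n => @mem_neighbor_vertex_iff F K hF5 w (hCK w hw) m n
      generalize ⌊w.re⌋ = m at *
      generalize ⌊w.im⌋ = n at *
      generalize ⌊x.re⌋ = m' at *
      generalize ⌊x.im⌋ = n' at *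
      have g1 : m' < m + 2 := by
        have : (m' : ℝ) < m + 2 := by linarith
        exact_mod_cast this
      have g2 : m < m' + 2 := by
        have : (m : ℝ) < m' + 2 := by linarith
        exact_mod_cast this
      have g3 : n' < n + 2 := by
        have : (n' : ℝ) < n + 2 := by linarith
        exact_mod_cast this
      have g4 : n < n' + 2 := by
        have : (n : ℝ) < n' + 2 := by linarith
        exact_mod_cast this
      have hm : |(m : ℝ) - w.re| ≤ 2 := abs_le.2 ⟨by linarith, by linarith⟩
      have hn : |(n : ℝ) - w.im| ≤ 2 := abs_le.2 ⟨by linarith, by linarith⟩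
      have hm' : |(m' : ℝ) - w.re| ≤ 2 := abs_le.2 ⟨by linarith, by linarith⟩
      have hn' : |(n' : ℝ) - w.im| ≤ 2 := abs_le.2 ⟨by linarith, by linarith⟩
      have s1 : (⟨m, n⟩ : ℂ) ∈ F ↔ (⟨m', n⟩ : ℂ) ∈ F := by
        obtain rfl | rfl | rfl : m' = m ∨ m' = m + 1 ∨ m = m' + 1 := by omega
        · rfl
        · exact (key m n hm hn).1
        · exact (key m' n hm' hn).1.symm
      refine s1.trans ?_
      obtain rfl | rfl | rfl : n' = n ∨ n' = n + 1 ∨ n = n' + 1 := by omega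
      · rfl
      · exact (key m' n hm' hn).2.1
      · exact (key m' n' hm' hn').2.1.symm
    obtain ⟨w, hwC, hwM⟩ : ∃ w ∈ C, w ∉ openSquare M := by
      by_contra! h
      refine hCb (isBounded_iff_forall_norm_le.2 ⟨M + M, fun w hw => ?_⟩)
      exact (Complex.norm_le_abs_re_add_abs_im w).trans
        (add_le_add (h w hw).1.le (h w hw).2.le)
    refine (hconst z hzC w hwC).2 (hF2 (isGridSet_compl_openSquare M w hwM _ le_rfl ?_ le_rfl ?_))
    · exact Int.cast_le.2 (Int.floor_le_ceil w.re)
    · exact Int.cast_le.2 (Int.floor_le_ceil w.im)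
  obtain ⟨W, hWF, hzW, hWc, k, hkW, hkK⟩ := hVK z hzV
  have f1 := Int.floor_le z.re
  have f2 := Int.lt_floor_add_one z.re
  have f3 := Int.floor_le z.im
  have f4 := Int.lt_floor_add_one z.im
  have key := fun m n => @mem_neighbor_vertex_iff F K hF5 z (hCK z hzC) m n
  generalize ⌊z.re⌋ = m at *
  generalize ⌊z.im⌋ = n at *
  have hm : |(m : ℝ) - z.re| ≤ 2 := abs_le.2 ⟨by linarith, by linarith⟩
  have hn : |(n : ℝ) - z.im| ≤ 2 := abs_le.2 ⟨by linarith, by linarith⟩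
  have hm' : |((m + 1 : ℤ) : ℝ) - z.re| ≤ 2 := by
    push_cast; exact abs_le.2 ⟨by linarith, by linarith⟩
  have hn' : |((n + 1 : ℤ) : ℝ) - z.im| ≤ 2 := by
    push_cast; exact abs_le.2 ⟨by linarith, by linarith⟩
  have e1 := (key m n hm hn).2.2 hzF
  have e2 := ((key (m + 1) n hm' hn).2.2 ((key m n hm hn).1.1 hzF)).2
  have e3 := ((key m (n + 1) hm hn').2.2 ((key m n hm hn).2.1.1 hzF)).1
  let cell : Set ℂ := Ioo (m : ℝ) (m + 1) ×ℂ Ioo (n : ℝ) (n + 1)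
  let closedCell : Set ℂ := Icc (m : ℝ) (m + 1) ×ℂ Icc (n : ℝ) (n + 1)
  have hcover : closedCell \ cell ⊆ F := by
    rintro x ⟨⟨hx1, hx2⟩, hx⟩
    rcases hx1.1.eq_or_lt with h | h
    · exact e1.2 ⟨hx1.1, h.ge, hx2.1, by push_cast; exact hx2.2⟩
    rcases hx1.2.eq_or_lt with h' | h'
    · exact e2 ⟨by push_cast; exact h'.ge, by push_cast; exact h'.le, hx2.1,
        by push_cast; exact hx2.2⟩
    rcases hx2.1.eq_or_lt with g | g
    · exact e1.1 ⟨hx1.1, by push_cast; exact hx1.2, g.le, g.ge⟩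
    rcases hx2.2.eq_or_lt with g' | g'
    · exact e3 ⟨hx1.1, by push_cast; exact hx1.2, by push_cast; exact g'.ge,
        by push_cast; exact g'.le⟩
    · exact absurd ⟨⟨h, h'⟩, ⟨g, g'⟩⟩ hx
  have hWsub : W ⊆ cell := by
    refine hWc.subset_left_of_subset_union (v := closedCellᶜ) (isOpen_Ioo.reProdIm isOpen_Ioo)
      (isClosed_Icc.reProdIm isClosed_Icc).isOpen_compl ?_ ?_ ⟨z, hzW, ?_⟩
    · exact disjoint_compl_right_iff_subset.2
        fun x hx => ⟨Ioo_subset_Icc_self hx.1, Ioo_subset_Icc_self hx.2⟩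
    · intro x hx
      by_contra h
      rw [mem_union, not_or, notMem_compl_iff] at h
      exact hWF hx (hcover ⟨h.2, h.1⟩)
    · by_contra h
      exact hWF hzW (hcover ⟨⟨⟨f1, f2.le⟩, ⟨f3, f4.le⟩⟩, h⟩)
  obtain ⟨⟨k1, k2⟩, ⟨k3, k4⟩⟩ := hWsub hkW
  have h1 := hCK z hzC k hkK
  have h2 := Complex.norm_le_abs_re_add_abs_im (z - k)
  have h3 : |(z - k).re| ≤ 1 := by
    rw [Complex.sub_re, abs_le]
    constructor <;> linarith
  have h4 : |(z - k).im| ≤ 1 := by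
    rw [Complex.sub_im, abs_le]
    constructor <;> linarith
  rw [dist_eq_norm] at h1
  linarith

theorem Complex.isPreconnected_setOf_le_norm {r : ℝ} (hr : 0 < r) :
    IsPreconnected {z : ℂ | r ≤ ‖z‖} := by
  have hconv : Convex ℝ {z : ℂ | Real.log r ≤ z.re} := convex_halfSpace_re_ge _
  convert hconv.isPreconnected.image Complex.exp Complex.continuous_exp.continuousOn using 1
  ext z
  constructor
  · intro hz
    have hz0 : 0 < ‖z‖ := hr.trans_le hz
    refine ⟨Complex.log z, ?_, Complex.exp_log (norm_pos_iff.1 hz0)⟩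
    rw [mem_ofPred_eq, Complex.log_re]
    exact Real.log_le_log hr hz
  · rintro ⟨w, hw, rfl⟩
    rw [mem_ofPred_eq, Complex.norm_exp]
    exact (Real.log_le_iff_le_exp hr).1 hw

theorem Complex.not_isBounded_setOf_le_norm (r : ℝ) :
    ¬ Bornology.IsBounded {z : ℂ | r ≤ ‖z‖} := by
  intro h
  obtain ⟨B, hB⟩ := h.exists_norm_le
  have h1 : ‖((|r| + |B| + 1 : ℝ) : ℂ)‖ = |r| + |B| + 1 := by
    rw [Complex.norm_real, Real.norm_of_nonneg (by positivity)]
  have h2 := hB ((|r| + |B| + 1 : ℝ) : ℂ) (by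
    rw [mem_ofPred_eq, h1]
    linarith [le_abs_self r, abs_nonneg B])
  rw [h1] at h2
  linarith [le_abs_self B, abs_nonneg r]

/-- Points of a closed set disjoint from `K` escape to infinity while staying uniformly far from
`K`, provided that the complement of `K` is connected. -/
theorem exists_unbounded_preconnected_far {K Z : Set ℂ} (hK : IsCompact K)
    (hKc : IsConnected Kᶜ) (hZ : IsClosed Z) (hZK : Disjoint Z K) :
    ∃ δ > 0, ∀ z ∈ Z, ∃ C : Set ℂ, z ∈ C ∧ IsPreconnected C ∧ ¬ Bornology.IsBounded C ∧
      ∀ w ∈ C, ∀ k ∈ K, δ ≤ dist w k := by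
  obtain ⟨R, hR0, hR⟩ := hK.isBounded.exists_pos_norm_le
  let E : Set ℂ := {z | R + 1 ≤ ‖z‖}
  have hEc : IsPreconnected E := Complex.isPreconnected_setOf_le_norm (by linarith)
  have hEb : ¬ Bornology.IsBounded E := Complex.not_isBounded_setOf_le_norm _
  have hEcl : IsClosed E := isClosed_le continuous_const continuous_norm
  have hEK : E ⊆ Kᶜ := fun z hz hzK => by
    have h1 := hR z hzK
    have h2 : R + 1 ≤ ‖z‖ := hz
    linarith
  obtain ⟨y, hy⟩ : E.Nonempty := by
    rw [nonempty_iff_ne_empty]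
    intro h
    exact hEb (h ▸ Bornology.isBounded_empty)
  have hpc : IsPathConnected Kᶜ := hK.isClosed.isOpen_compl.isConnected_iff_isPathConnected.1 hKc
  have hcpt : IsCompact (Z ∩ Metric.closedBall 0 (R + 1)) :=
    (isCompact_closedBall 0 (R + 1)).inter_left hZ
  obtain ⟨δ, hδ, h⟩ : ∃ δ > 0, ∀ z ∈ Z ∩ Metric.closedBall 0 (R + 1), ∃ C : Set ℂ, z ∈ C ∧
      IsPreconnected C ∧ ¬ Bornology.IsBounded C ∧ ∀ w ∈ C, ∀ k ∈ K, δ ≤ dist w k := by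
    refine hcpt.induction_on (p := fun s => ∃ δ > 0, ∀ z ∈ s, ∃ C : Set ℂ, z ∈ C ∧
      IsPreconnected C ∧ ¬ Bornology.IsBounded C ∧ ∀ w ∈ C, ∀ k ∈ K, δ ≤ dist w k)
      ⟨1, one_pos, by simp⟩ ?_ ?_ ?_
    · rintro s t hst ⟨δ, hδ, h⟩
      exact ⟨δ, hδ, fun z hz => h z (hst hz)⟩
    · rintro s t ⟨δ, hδ, h⟩ ⟨δ', hδ', h'⟩
      refine ⟨min δ δ', lt_min hδ hδ', ?_⟩
      rintro z (hz | hz)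
      · obtain ⟨C, h1, h2, h3, h4⟩ := h z hz
        exact ⟨C, h1, h2, h3, fun w hw k hk => (min_le_left _ _).trans (h4 w hw k hk)⟩
      · obtain ⟨C, h1, h2, h3, h4⟩ := h' z hz
        exact ⟨C, h1, h2, h3, fun w hw k hk => (min_le_right _ _).trans (h4 w hw k hk)⟩
    · rintro z ⟨hz, -⟩
      obtain ⟨γ, hγ⟩ := hpc.joinedIn z (disjoint_left.1 hZK hz) y (hEK hy)
      let T : Set ℂ := range γ ∪ E
      have hTcl : IsClosed T := (isCompact_range γ.continuous).isClosed.union hEcl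
      have hzT : z ∈ T := Or.inl ⟨0, γ.source⟩
      have hTc : IsPreconnected T := IsPreconnected.union y ⟨1, γ.target⟩ hy
        (isPreconnected_range γ.continuous) hEc
      have hTK : Disjoint K T := by
        refine disjoint_left.2 ?_
        rintro _ hk (⟨t, rfl⟩ | h)
        · exact hγ t hk
        · exact hEK h hk
      obtain ⟨δ, hδ, hdisj⟩ := hTK.exists_thickenings hK hTcl
      have hfar : ∀ w ∈ T ∪ Metric.ball z δ, ∀ k ∈ K, δ ≤ dist w k := by
        intro w hw k hk
        by_contra! hlt
        refine disjoint_left.1 hdisj (Metric.mem_thickening_iff.2 ⟨k, hk, hlt⟩) ?_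
        rcases hw with hw | hw
        · exact Metric.self_subset_thickening hδ T hw
        · exact Metric.mem_thickening_iff.2 ⟨z, hzT, hw⟩
      refine ⟨Metric.ball z δ, mem_nhdsWithin_of_mem_nhds (Metric.ball_mem_nhds z hδ), δ, hδ,
        fun x hx => ⟨T ∪ Metric.ball z δ, Or.inr hx, ?_, ?_, hfar⟩⟩
      · exact IsPreconnected.union z hzT (Metric.mem_ball_self hδ) hTc
          (convex_ball z δ).isPreconnected
      · exact fun hb => hEb (hb.subset (subset_union_right.trans subset_union_left))
  refine ⟨min δ 1, lt_min hδ one_pos, fun z hz => ?_⟩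
  rcases le_total ‖z‖ (R + 1) with hz1 | hz1
  · obtain ⟨C, h1, h2, h3, h4⟩ := h z ⟨hz, mem_closedBall_zero_iff.2 hz1⟩
    exact ⟨C, h1, h2, h3, fun w hw k hk => (min_le_left _ _).trans (h4 w hw k hk)⟩
  · refine ⟨E, hz1, hEc, hEb, fun w hw k hk => (min_le_right _ _).trans ?_⟩
    have h1 : R + 1 ≤ ‖w‖ := hw
    have h2 := norm_sub_norm_le w k
    rw [dist_eq_norm]
    linarith [hR k hk]

theorem IsCompact.exists_hasSimplyConnectedPieces {K A : Set ℂ} (hK : IsCompact K)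
    (hKc : IsConnected Kᶜ) (hA : IsOpen A) (hKA : K ⊆ A) :
    ∃ V, K ⊆ V ∧ V ⊆ A ∧ HasSimplyConnectedPieces V := by
  obtain ⟨δ, hδ, h⟩ := exists_unbounded_preconnected_far hK hKc hA.isClosed_compl
    (disjoint_compl_left_iff_subset.2 hKA)
  have ha : ((20 / δ : ℝ) : ℂ) ≠ 0 := Complex.ofReal_ne_zero.2 (by positivity)
  let e : ℂ ≃ₜ ℂ := Homeomorph.mulLeft₀ ((20 / δ : ℝ) : ℂ) ha
  have he : ∀ w x, dist (e w) (e x) = 20 / δ * dist w x := by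
    intro w x
    change dist (((20 / δ : ℝ) : ℂ) * w) (((20 / δ : ℝ) : ℂ) * x) = _
    rw [dist_eq_norm, ← mul_sub, norm_mul, Complex.norm_real, Real.norm_of_nonneg (by positivity),
      dist_eq_norm]
  obtain ⟨V, hKV, hVA, hV⟩ := exists_hasSimplyConnectedPieces_disjoint (Z := e '' Aᶜ)
    (hK.image e.continuous) (by
      rintro _ ⟨z, hz, rfl⟩
      obtain ⟨C, h1, h2, h3, h4⟩ := h z hz
      refine ⟨e '' C, mem_image_of_mem e h1, h2.image e e.continuous.continuousOn, ?_, ?_⟩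
      · intro hb
        obtain ⟨B, hB⟩ := Metric.isBounded_iff.1 hb
        refine h3 (Metric.isBounded_iff.2 ⟨B / (20 / δ), fun w hw x hx => ?_⟩)
        rw [le_div_iff₀' (by positivity), ← he]
        exact hB (mem_image_of_mem e hw) (mem_image_of_mem e hx)
      · rintro _ ⟨w, hw, rfl⟩ _ ⟨k, hk, rfl⟩
        have h5 : 20 / δ * δ ≤ 20 / δ * dist w k :=
          mul_le_mul_of_nonneg_left (h4 w hw k hk) (by positivity)
        rw [div_mul_cancel₀ _ hδ.ne'] at h5
        rw [he]
        linarith)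
  refine ⟨e ⁻¹' V, image_subset_iff.1 hKV, fun z hz => ?_, hV.preimage e⟩
  by_contra hzA
  exact disjoint_left.1 hVA hz (mem_image_of_mem e hzA)

theorem exists_continuousOn_exp_eq_sub {V : Set ℂ} {p : ℂ} (hV : IsOpen V) (hp : p ∉ V)
    (hVs : ∀ z ∈ V, SimplyConnectedSpace (connectedComponentIn V z)) :
    ∃ g : ℂ → ℂ, ContinuousOn g V ∧ ∀ z ∈ V, Complex.exp (g z) = z - p := by
  have hlog : ∀ S : Set ℂ, ∃ f : ℂ → ℂ, (∃ z ∈ V, S = connectedComponentIn V z) →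
      ContinuousOn f S ∧ ∀ z ∈ S, Complex.exp (f z) = z - p := by
    intro S
    by_cases hS : ∃ z ∈ V, S = connectedComponentIn V z
    · obtain ⟨z, hz, rfl⟩ := hS
      have hs : IsSimplyConnected (connectedComponentIn V z) := hVs z hz
      obtain ⟨f, hf1, hf2⟩ := Complex.exists_continuousOn_eqOn_exp_comp hs
        hV.connectedComponentIn (g := fun w => w - p) (by fun_prop) (by
          rintro ⟨w, hw, hwp⟩
          exact hp (sub_eq_zero.1 hwp ▸ connectedComponentIn_subset V z hw))
      exact ⟨f, fun _ => ⟨hf1, hf2⟩⟩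
    · exact ⟨id, fun h => absurd h hS⟩
  choose f hf using hlog
  refine ⟨fun z => f (connectedComponentIn V z) z, fun z hz => ?_,
    fun z hz => (hf _ ⟨z, hz, rfl⟩).2 z (mem_connectedComponentIn hz)⟩
  have hmem := hV.connectedComponentIn.mem_nhds (mem_connectedComponentIn hz)
  have hcont := (hf _ ⟨z, hz, rfl⟩).1.continuousAt hmem
  refine (hcont.congr ?_).continuousWithinAt
  filter_upwards [hmem] with w hw
  rw [connectedComponentIn_eq hw]

/-- The function `z ↦ z - p` has no continuous logarithm on the frontier of a bounded open
neighborhood of `p`. -/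
theorem not_exists_log_frontier {K U : Set ℂ} {p : ℂ} (hK : IsClosed K)
    (hUb : Bornology.IsBounded U) (hpU : p ∈ U) (hUK : frontier U ⊆ K) {g : ℂ → ℂ}
    (hg : ContinuousOn g K) (hgK : ∀ z ∈ K, Complex.exp (g z) = z - p) : False := by
  classical
  obtain ⟨G, hG⟩ := ContinuousMap.exists_restrict_eq hK ⟨K.domRestrict g, hg.domRestrict⟩
  have hGK : ∀ z ∈ K, G z = g z := fun z hz => DFunLike.congr_fun hG ⟨z, hz⟩
  let F : ℂ → ℂ := U.piecewise (fun z => Complex.exp (G z)) (fun z => z - p)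
  have hF : Continuous F := Continuous.piecewise
    (fun z hz => by rw [hGK z (hUK hz), hgK z (hUK hz)]) (by fun_prop) (by fun_prop)
  have hF0 : ∀ z, F z ≠ 0 := by
    intro z
    by_cases hz : z ∈ U
    · simp [F, hz, Complex.exp_ne_zero]
    · simp only [F, hz, piecewise_eq_of_notMem, not_false_eq_true]
      exact fun h => hz (sub_eq_zero.1 h ▸ hpU)
  have huniv : IsSimplyConnected (univ : Set ℂ) := by
    have := convex_univ.contractibleSpace (s := (univ : Set ℂ)) univ_nonempty
    exact SimplyConnectedSpace.ofContractible _
  obtain ⟨L, hL1, hL2⟩ := Complex.exists_continuousOn_eqOn_exp_comp huniv isOpen_univ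
    hF.continuousOn (by rintro ⟨z, -, hz⟩; exact hF0 z hz)
  rw [continuousOn_univ] at hL1
  obtain ⟨ρ, hρ0, hρ⟩ := hUb.subset_ball_lt 0 p
  let c : ℝ → ℂ := fun t => p + Complex.exp (Real.log ρ + t * Complex.I)
  have hcU : ∀ t, c t ∉ U := by
    intro t ht
    have := hρ ht
    rw [Metric.mem_ball, dist_eq_norm, add_sub_cancel_left, Complex.norm_exp] at this
    simp [Real.exp_log hρ0] at this
  have hexp : ∀ t, Complex.exp (L (c t)) = Complex.exp (Real.log ρ + t * Complex.I) := by
    intro t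
    have := hL2 (mem_univ (c t))
    simpa [F, hcU t, c] using this
  obtain ⟨n, hn⟩ := Complex.exp_eq_exp_iff_exists_int.1 (hexp 0)
  have heq := Complex.eq_of_exp_comp_eq (f := fun t : ℝ => L (c t))
    (g := fun t : ℝ => (Real.log ρ + t * Complex.I : ℂ) + n * (2 * Real.pi * Complex.I))
    (by fun_prop) (by fun_prop)
    (fun t => by rw [hexp, Complex.exp_add _ (n * _), Complex.exp_int_mul_two_pi_mul_I, mul_one])
    hn
  have h0 : c (2 * Real.pi) = c 0 := by
    simp [c, Complex.exp_add]
  have h1 := congr_fun heq (2 * Real.pi)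
  have h2 := congr_fun heq 0
  simp only [h0] at h1
  have h3 := h1.symm.trans h2
  simp [Real.pi_ne_zero] at h3

theorem isConnected_compl_of_forall_exists_open {K : Set ℂ} (hK : IsCompact K)
    (h : ∀ A : Set ℂ, IsOpen A → K ⊆ A → ∃ V : Set ℂ, IsOpen V ∧ K ⊆ V ∧ V ⊆ A ∧
      ∀ z ∈ V, SimplyConnectedSpace (connectedComponentIn V z)) : IsConnected Kᶜ := by
  obtain ⟨R, hR0, hR⟩ := hK.isBounded.exists_pos_norm_le
  let E : Set ℂ := {z | R + 1 ≤ ‖z‖}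
  have hEc : IsPreconnected E := Complex.isPreconnected_setOf_le_norm (by linarith)
  have hEK : E ⊆ Kᶜ := fun z hz hzK => by
    have h1 := hR z hzK
    have h2 : R + 1 ≤ ‖z‖ := hz
    linarith
  have hnonempty : (Kᶜ).Nonempty := nonempty_compl.2 hK.ne_univ
  have key : ∀ u v : Set ℂ, IsOpen u → IsOpen v → Kᶜ ⊆ u ∪ v → Kᶜ ∩ (u ∩ v) = ∅ → E ⊆ v →
      Kᶜ ⊆ v := by
    intro u v hu hv huv hdisj hEv p hpK
    by_contra hpv
    have hdisj' : ∀ z, z ∉ K → z ∈ u → z ∉ v := fun z h1 h2 h3 =>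
      (hdisj ▸ (⟨h1, h2, h3⟩ : z ∈ Kᶜ ∩ (u ∩ v)) : z ∈ (∅ : Set ℂ))
    have hKo : IsOpen Kᶜ := hK.isClosed.isOpen_compl
    obtain ⟨V, hVo, hKV, hVp, hVs⟩ := h {p}ᶜ isOpen_compl_singleton
      (subset_compl_singleton_iff.2 hpK)
    obtain ⟨g, hg, hgV⟩ := exists_continuousOn_exp_eq_sub hVo
      (subset_compl_singleton_iff.1 hVp) hVs
    refine not_exists_log_frontier (U := u ∩ Kᶜ) hK.isClosed ?_
      ⟨(huv hpK).resolve_right hpv, hpK⟩ ?_ (hg.mono hKV) fun z hz => hgV z (hKV hz)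
    · refine isBounded_iff_forall_norm_le.2 ⟨R + 1, fun z hz => ?_⟩
      by_contra! hlt
      exact hdisj' z hz.2 hz.1 (hEv hlt.le)
    · intro z hz
      by_contra hzK
      rw [(hu.inter hKo).frontier_eq] at hz
      have hzv : z ∈ v := (huv hzK).resolve_left fun h => hz.2 ⟨h, hzK⟩
      obtain ⟨x, hxv, hxu⟩ := mem_closure_iff.1 hz.1 _ hv hzv
      exact hdisj' x hxu.2 hxu.1 hxv
  refine ⟨hnonempty, isPreconnected_iff_subset_of_disjoint.2 fun u v hu hv huv hdisj => ?_⟩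
  rcases isPreconnected_iff_subset_of_disjoint.1 hEc u v hu hv (hEK.trans huv)
    (subset_eq_empty (inter_subset_inter_left _ hEK) hdisj) with hE | hE
  · exact Or.inl (key v u hv hu (by rwa [union_comm]) (by rwa [inter_comm v u]) hE)
  · exact Or.inr (key u v hu hv huv hdisj hE)

/-- Let `K ⊆ ℂ` be compact. Then `ℂ \ K` is connected if and only if for every
open set `A ⊇ K` there exists an open set `V` with `K ⊆ V ⊆ A` such that every
connected component of `V` is simply connected. -/
theorem compl_connected_iff_exists_open_simplyConnected_components (K : Set ℂ)
    (hK : IsCompact K) :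
    IsConnected Kᶜ ↔
      ∀ A : Set ℂ, IsOpen A → K ⊆ A →
        ∃ V : Set ℂ, IsOpen V ∧ K ⊆ V ∧ V ⊆ A ∧
          ∀ z ∈ V, SimplyConnectedSpace (connectedComponentIn V z) := by
  refine ⟨fun hKc A hA hKA => ?_, isConnected_compl_of_forall_exists_open hK⟩
  obtain ⟨V, hKV, hVA, hV⟩ := hK.exists_hasSimplyConnectedPieces hKc hA hKA
  exact ⟨V, hV.isOpen, hKV, hVA, fun z hz => hV.simplyConnectedSpace_connectedComponentIn hz⟩
end

section
/- Let K, L ⊆ ℂ be disjoint compact sets such that ℂ \ K and ℂ \ L are both connected. Then ℂ \ (K ∪ L) is connected. -/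
open Set Topology in
/-- Existence of continuous logarithms is invariant under homotopy: if `F t` is a family of
nonvanishing functions on a compact space and one member has a continuous logarithm, all do. -/
theorem exists_continuous_log_of_homotopic {T Y : Type*} [TopologicalSpace T]
    [PreconnectedSpace T] [TopologicalSpace Y] [CompactSpace Y] {F : T × Y → ℂ}
    (hF : Continuous F) (hF0 : ∀ x, F x ≠ 0) {t₀ : T}
    (h₀ : ∃ g : C(Y, ℂ), ∀ y, Complex.exp (g y) = F (t₀, y)) (t : T) :
    ∃ g : C(Y, ℂ), ∀ y, Complex.exp (g y) = F (t, y) := by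
  set A : Set T := {t | ∃ g : C(Y, ℂ), ∀ y, Complex.exp (g y) = F (t, y)}
  have hstep : ∀ a b : T, (∀ y, F (b, y) / F (a, y) ∈ Complex.slitPlane) → a ∈ A → b ∈ A := by
    rintro a b hab ⟨g, hg⟩
    have hc : Continuous fun y => g y + Complex.log (F (b, y) / F (a, y)) := by
      refine g.continuous.add (Continuous.clog ?_ hab)
      exact Continuous.div (by fun_prop) (by fun_prop) fun y => hF0 _
    refine ⟨⟨_, hc⟩, fun y => ?_⟩
    have h1 := hF0 (a, y)
    have h2 := hF0 (b, y)
    simp only [ContinuousMap.coe_mk]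
    rw [Complex.exp_add, hg, Complex.exp_log (div_ne_zero h2 h1)]
    field_simp
  have hnear : ∀ a : T, ∀ᶠ b in 𝓝 a, ∀ y ∈ (univ : Set Y),
      F (b, y) / F (a, y) ∈ Complex.slitPlane ∧ F (a, y) / F (b, y) ∈ Complex.slitPlane := by
    intro a
    refine isCompact_univ.eventually_forall_of_forall_eventually fun y _ => ?_
    have hc₁ : Continuous fun z : T × Y => F (z.1, z.2) / F (a, z.2) :=
      Continuous.div (by fun_prop) (by fun_prop) fun z => hF0 _
    have hc₂ : Continuous fun z : T × Y => F (a, z.2) / F (z.1, z.2) :=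
      Continuous.div (by fun_prop) (by fun_prop) fun z => hF0 _
    have hone : F (a, y) / F (a, y) ∈ Complex.slitPlane := by simp [div_self (hF0 (a, y))]
    exact (hc₁.continuousAt.eventually_mem (Complex.isOpen_slitPlane.mem_nhds hone)).and
      (hc₂.continuousAt.eventually_mem (Complex.isOpen_slitPlane.mem_nhds hone))
  have hopen : IsOpen A := isOpen_iff_mem_nhds.2 fun a ha => by
    filter_upwards [hnear a] with b hb
    exact hstep a b (fun y => (hb y trivial).1) ha
  have hclosed : IsClosed A := isOpen_compl_iff.1 <| isOpen_iff_mem_nhds.2 fun a ha => by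
    filter_upwards [hnear a] with b hb hbA
    exact ha (hstep b a (fun y => (hb y trivial).2) hbA)
  have huniv : A = univ := IsClopen.eq_univ ⟨hclosed, hopen⟩ ⟨t₀, h₀⟩
  exact huniv.ge (mem_univ t)

/-- If a compact set `K` does not separate the plane, then `z - p` has a continuous logarithm
on `K` for every `p ∉ K`. -/
theorem exists_continuous_log_sub_of_isPreconnected_compl {K : Set ℂ} (hK : IsCompact K)
    (hKc : IsPreconnected Kᶜ) {p : ℂ} (hp : p ∉ K) :
    ∃ G : C(ℂ, ℂ), ∀ z ∈ K, Complex.exp (G z) = z - p := by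
  have : CompactSpace K := isCompact_iff_compactSpace.1 hK
  have : PreconnectedSpace ↥Kᶜ := isPreconnected_iff_preconnectedSpace.1 hKc
  obtain ⟨R, hR⟩ := hK.isBounded.exists_norm_le
  have hre : ∀ z ∈ K, 0 < (z - ((-(R + 1) : ℝ) : ℂ)).re := fun z hz => by
    have h1 := abs_le.1 ((Complex.abs_re_le_norm z).trans (hR z hz))
    rw [Complex.sub_re, Complex.ofReal_re]
    linarith [h1.1]
  have hfar : ((-(R + 1) : ℝ) : ℂ) ∈ Kᶜ := fun h => by simpa using hre _ h
  obtain ⟨g, hg⟩ := exists_continuous_log_of_homotopic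
    (F := fun x : ↥Kᶜ × K => (x.2 : ℂ) - x.1) (by fun_prop)
    (fun x h => x.1.2 (sub_eq_zero.1 h ▸ x.2.2)) (t₀ := ⟨_, hfar⟩)
    ⟨⟨fun z => Complex.log (z - ((-(R + 1) : ℝ) : ℂ)),
      Continuous.clog (by fun_prop) fun z => Or.inl (hre z z.2)⟩,
      fun z => Complex.exp_log (Complex.slitPlane_ne_zero (Or.inl (hre z z.2)))⟩ ⟨p, hp⟩
  obtain ⟨G, hG⟩ := g.exists_restrict_eq hK.isClosed
  refine ⟨G, fun z hz => ?_⟩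
  rw [← hg ⟨z, hz⟩, ← hG]
  rfl

/-- A nonzero multiple of the inclusion of the unit circle has no continuous logarithm. -/
theorem not_exists_continuous_log_sphere (c : ℂ) :
    ¬ ∃ h : C(Metric.sphere (0 : ℂ) 1, ℂ), ∀ u, Complex.exp (h u) = c * u := by
  rintro ⟨h, hh⟩
  have hc : c ≠ 0 := by
    rintro rfl
    exact Complex.exp_ne_zero _ ((hh ⟨1, by simp⟩).trans (zero_mul _))
  have hconn : IsPreconnected (Metric.sphere (0 : ℂ) 1) :=
    isPreconnected_sphere (by simp) 0 1
  have : PreconnectedSpace (Metric.sphere (0 : ℂ) 1) :=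
    isPreconnected_iff_preconnectedSpace.1 hconn
  have hexp : ∀ u, Complex.exp (h u - h (-u)) = -1 := fun u => by
    have hu : (u : ℂ) ≠ 0 := ne_zero_of_mem_unit_sphere u
    rw [Complex.exp_sub, hh, hh, coe_neg_sphere]
    field_simp
  have hint : ∀ u, ∃ n : ℤ, (h u - h (-u)) / (2 * Real.pi * Complex.I) - 1 / 2 = n := fun u => by
    have h1 : Complex.exp (h u - h (-u)) = Complex.exp (Real.pi * Complex.I) := by
      rw [hexp, Complex.exp_pi_mul_I]
    obtain ⟨n, hn⟩ := Complex.exp_eq_exp_iff_exists_int.1 h1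
    refine ⟨n, ?_⟩
    have hpi : (Real.pi : ℂ) ≠ 0 := by exact_mod_cast Real.pi_ne_zero
    rw [hn]
    field_simp [Complex.I_ne_zero]
    ring
  choose n hn using hint
  have hncont : Continuous n := by
    refine Int.isClosedEmbedding_coe_real.isInducing.continuous_iff.2 ?_
    have h2 : ((↑) : ℤ → ℝ) ∘ n =
        fun u => ((h u - h (-u)) / (2 * Real.pi * Complex.I) - 1 / 2).re := by
      funext u
      rw [hn, Complex.intCast_re, Function.comp_apply]
    rw [h2]
    fun_prop
  let e : Metric.sphere (0 : ℂ) 1 := ⟨1, by simp⟩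
  have hconst : n e = n (-e) := PreconnectedSpace.constant ‹_› hncont
  have h3 := hn e
  have h4 := hn (-e)
  rw [neg_neg, ← hconst, ← h3] at h4
  have h5 : h e - h (-e) = 0 := by
    have hpi : (Real.pi : ℂ) ≠ 0 := by exact_mod_cast Real.pi_ne_zero
    field_simp [Complex.I_ne_zero] at h4
    linear_combination (-1 / 2 : ℂ) * h4
  have h6 := hexp e
  rw [h5, Complex.exp_zero] at h6
  norm_num at h6

/-- The exterior of a disc is preconnected. -/
theorem isPreconnected_setOf_lt_norm {R : ℝ} (hR : 0 < R) :
    IsPreconnected {z : ℂ | R < ‖z‖} := by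
  have himage : {z : ℂ | R < ‖z‖} = Complex.exp '' {w | Real.log R < w.re} := by
    ext z
    constructor
    · intro hz
      have hz0 : z ≠ 0 := norm_pos_iff.1 (hR.trans hz)
      exact ⟨Complex.log z, by simpa [Complex.log_re] using Real.log_lt_log hR hz,
        Complex.exp_log hz0⟩
    · rintro ⟨w, hw, rfl⟩
      simpa [Complex.norm_exp] using (Real.log_lt_iff_lt_exp hR).1 hw
  rw [himage]
  exact (convex_halfSpace_re_gt _).isPreconnected.image _ Complex.continuous_exp.continuousOn

/-- A bounded open set `U` such that both `U` and the rest of the complement of `X` are open is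
empty, provided that `z - p` has a continuous logarithm on `X` for every `p ∉ X`. -/
theorem eq_empty_of_exists_continuous_log {X U V : Set ℂ} (hU : IsOpen U) (hV : IsOpen V)
    (hUV : Disjoint U V) (hX : Xᶜ = U ∪ V) {R : ℝ} (hR : {z : ℂ | R < ‖z‖} ⊆ V)
    (hlog : ∀ p ∉ X, ∃ G : C(ℂ, ℂ), ∀ z ∈ X, Complex.exp (G z) = z - p) : U = ∅ := by
  classical
  by_contra hne
  obtain ⟨p, hp⟩ := Set.nonempty_iff_ne_empty.2 hne
  have hpV : p ∉ V := hUV.notMem_of_mem_left hp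
  obtain ⟨G, hG⟩ := hlog p (show p ∈ Xᶜ from hX ▸ Or.inl hp)
  have hfront : frontier V ⊆ X := by
    intro z hz
    rw [hV.frontier_eq] at hz
    by_contra hzX
    rcases (show z ∈ U ∪ V from hX ▸ hzX) with hzU | hzV
    · exact (hUV.symm.closure_left hU).notMem_of_mem_left hz.1 hzU
    · exact hz.2 hzV
  set F : ℂ → ℂ := V.piecewise (fun z => z - p) (fun z => Complex.exp (G z)) with hFdef
  have hF : Continuous F :=
    Continuous.piecewise (fun z hz => (hG z (hfront hz)).symm) (by fun_prop) (by fun_prop)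
  have hF0 : ∀ z, F z ≠ 0 := by
    intro z
    by_cases hz : z ∈ V
    · rw [hFdef, Set.piecewise_eq_of_mem _ _ _ hz]
      exact fun h => hpV (sub_eq_zero.1 h ▸ hz)
    · rw [hFdef, Set.piecewise_eq_of_notMem _ _ _ hz]
      exact Complex.exp_ne_zero _
  set S : ℝ := |R| + ‖p‖ + 1
  obtain ⟨h, hh⟩ := exists_continuous_log_of_homotopic
    (F := fun x : ℝ × Metric.sphere (0 : ℂ) 1 => F (p + x.1 * x.2)) (by fun_prop)
    (fun x => hF0 _) (t₀ := 0)
    ⟨ContinuousMap.const _ (Complex.log (F p)), fun u => by simp [Complex.exp_log (hF0 p)]⟩ S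
  refine not_exists_continuous_log_sphere (S : ℂ) ⟨h, fun u => ?_⟩
  have hmem : p + S * u ∈ V := by
    apply hR
    have hu : ‖(u : ℂ)‖ = 1 := by simp
    have hS : 0 ≤ S := by positivity
    have h1 : ‖(S : ℂ) * u‖ = S := by rw [norm_mul, hu, mul_one, Complex.norm_of_nonneg hS]
    have h2 : ‖(S : ℂ) * u‖ ≤ ‖p + S * u‖ + ‖p‖ := by
      simpa using norm_sub_le (p + S * u) p
    have h3 := le_abs_self R
    change R < _
    rw [h1] at h2
    linarith
  rw [hh u, hFdef]
  dsimp only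
  rw [Set.piecewise_eq_of_mem _ _ _ hmem]
  ring

/-- A compact set on which every `z - p` with `p ∉ X` has a continuous logarithm does not
separate the plane. -/
theorem IsCompact.isPreconnected_compl_of_exists_continuous_log {X : Set ℂ} (hX : IsCompact X)
    (hlog : ∀ p ∉ X, ∃ G : C(ℂ, ℂ), ∀ z ∈ X, Complex.exp (G z) = z - p) :
    IsPreconnected Xᶜ := by
  obtain ⟨R, hR0, hR⟩ := hX.isBounded.exists_pos_norm_le
  have hfar : {z : ℂ | R < ‖z‖} ⊆ Xᶜ := fun z hz hzX => (hR z hzX).not_gt hz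
  have hXo : IsOpen Xᶜ := hX.isClosed.isOpen_compl
  have key : ∀ u v : Set ℂ, IsOpen u → IsOpen v → Xᶜ ⊆ u ∪ v → Xᶜ ∩ (u ∩ v) = ∅ →
      {z : ℂ | R < ‖z‖} ⊆ v → Xᶜ ⊆ v := by
    intro u v hu hv hcover hdisj hRv
    have hempty : Xᶜ ∩ u = ∅ := by
      refine eq_empty_of_exists_continuous_log (V := Xᶜ ∩ v) (hXo.inter hu) (hXo.inter hv) ?_ ?_
        (Set.subset_inter hfar hRv) hlog
      · rw [Set.disjoint_iff_inter_eq_empty, ← Set.inter_inter_distrib_left, hdisj]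
      · rw [← Set.inter_union_distrib_left, Set.inter_eq_left.2 hcover]
    intro z hz
    exact (hcover hz).resolve_left fun hzu => hempty.le ⟨hz, hzu⟩
  rw [isPreconnected_iff_subset_of_disjoint]
  intro u v hu hv hcover hdisj
  have hsplit := isPreconnected_iff_subset_of_disjoint.1 (isPreconnected_setOf_lt_norm hR0)
    u v hu hv (hfar.trans hcover)
    (Set.subset_empty_iff.1 ((Set.inter_subset_inter_left _ hfar).trans hdisj.le))
  rcases hsplit with h | h
  · exact Or.inl (key v u hv hu (Set.union_comm u v ▸ hcover) (Set.inter_comm u v ▸ hdisj) h)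
  · exact Or.inr (key u v hu hv hcover hdisj h)

/-- Let `K, L ⊆ ℂ` be disjoint compact sets such that `ℂ \ K` and `ℂ \ L` are both
connected. Then `ℂ \ (K ∪ L)` is connected. -/
theorem compl_union_connected_of_disjoint_compact (K L : Set ℂ)
    (hK : IsCompact K) (hL : IsCompact L) (hdisj : Disjoint K L)
    (hKc : IsConnected Kᶜ) (hLc : IsConnected Lᶜ) :
    IsConnected (K ∪ L)ᶜ := by
  refine ⟨Set.nonempty_compl.2 (hK.union hL).ne_univ,
    (hK.union hL).isPreconnected_compl_of_exists_continuous_log fun p hp => ?_⟩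
  obtain ⟨G₁, hG₁⟩ := exists_continuous_log_sub_of_isPreconnected_compl hK hKc.isPreconnected
    fun h => hp (Or.inl h)
  obtain ⟨G₂, hG₂⟩ := exists_continuous_log_sub_of_isPreconnected_compl hL hLc.isPreconnected
    fun h => hp (Or.inr h)
  obtain ⟨f, hf0, hf1, -⟩ := exists_continuous_zero_one_of_isClosed hK.isClosed hL.isClosed hdisj
  refine ⟨⟨fun z => (1 - (f z : ℂ)) * G₁ z + (f z : ℂ) * G₂ z, by fun_prop⟩, ?_⟩
  rintro z (hz | hz)
  · simpa [hf0 hz] using hG₁ z hz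
  · simpa [hf1 hz] using hG₂ z hz
end

section
/- Let V₁, …, Vₙ be open, bounded, convex subsets of ℝ². Then the complement F = ℝ² \ (V₁ ∪ ⋯ ∪ Vₙ) has only finitely many connected components. -/
open Set Filter Topology Metric

/-- A compact Hausdorff space has finitely many connected components as soon as some finite set
meets every nonempty clopen set. -/
theorem finite_connectedComponents_of_inter_isClopen_nonempty {X : Type*} [TopologicalSpace X]
    [CompactSpace X] [T2Space X] {T : Set X} (hT : T.Finite)
    (h : ∀ K : Set X, IsClopen K → K.Nonempty → (K ∩ T).Nonempty) :
    Finite (ConnectedComponents X) := by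
  have := hT.to_subtype
  refine Finite.of_surjective (fun t : T => (t.1 : ConnectedComponents X)) fun c => ?_
  obtain ⟨x, rfl⟩ := ConnectedComponents.surjective_coe c
  by_contra! hne
  have hsep : ∀ t : T, ∃ K : Set X, IsClopen K ∧ x ∈ K ∧ t.1 ∉ K := by
    intro t
    have ht : t.1 ∉ connectedComponent x := fun hmem =>
      hne t (ConnectedComponents.coe_eq_coe'.2 hmem)
    rw [connectedComponent_eq_iInter_isClopen] at ht
    simpa [and_assoc] using ht
  choose K hK hxK htK using hsep
  obtain ⟨y, hy, hyT⟩ := h (⋂ t, K t) (isClopen_iInter_of_finite hK) ⟨x, mem_iInter.2 hxK⟩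
  exact htK ⟨y, hyT⟩ (mem_iInter.1 hy _)

/-- Let `p` lie outside a finite union of open convex sets, and let `q` lie in the closure of each
member whose closure contains `p`. Then the ray from `p` pointing away from `q` starts outside the
union. -/
theorem eventually_add_smul_sub_notMem_iUnion {E ι : Type*} [NormedAddCommGroup E]
    [NormedSpace ℝ E] [Finite ι] {V : ι → Set E} (hopen : ∀ i, IsOpen (V i))
    (hconv : ∀ i, Convex ℝ (V i)) {p q : E} (hp : p ∉ ⋃ i, V i)
    (hpq : ∀ i, p ∈ closure (V i) → q ∈ closure (V i)) :
    ∀ᶠ s : ℝ in 𝓝[>] 0, p + s • (p - q) ∉ ⋃ i, V i := by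
  simp only [mem_iUnion, not_exists, eventually_all]
  intro i
  by_contra hfreq
  simp only [not_eventually, not_not] at hfreq
  have hlim : Tendsto (fun s : ℝ => p + s • (p - q)) (𝓝[>] 0) (𝓝 p) := by
    have : Continuous fun s : ℝ => p + s • (p - q) := by fun_prop
    simpa using (this.tendsto 0).mono_left nhdsWithin_le_nhds
  have hq := hpq i (mem_closure_of_frequently_of_tendsto hfreq hlim)
  obtain ⟨s, hs, hs0⟩ := (hfreq.and_eventually self_mem_nhdsWithin).exists
  have hs0 : 0 < s := hs0
  rw [← (hopen i).interior_eq] at hs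
  have hsub := (hconv i).openSegment_interior_closure_subset_interior hs hq
  rw [(hopen i).interior_eq] at hsub
  refine hp (mem_iUnion.2 ⟨i, hsub ⟨1 / (1 + s), s / (1 + s), by positivity, by positivity,
    by field_simp, ?_⟩⟩)
  match_scalars <;> field_simp
  ring

theorem norm_lt_norm_add_smul_sub {E : Type*} [NormedAddCommGroup E] [InnerProductSpace ℝ E]
    {p q : E} (hne : p ≠ q) (hle : ‖q‖ ≤ ‖p‖) {s : ℝ} (hs : 0 < s) :
    ‖p‖ < ‖p + s • (p - q)‖ := by
  have hd : 0 < ‖p - q‖ := norm_pos_iff.2 (sub_ne_zero.2 hne)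
  have hin : 0 ≤ inner ℝ p (p - q) := by
    rw [inner_sub_right, real_inner_self_eq_norm_sq]
    nlinarith [real_inner_le_norm p q, norm_nonneg p]
  have hsq := norm_add_sq_real p (s • (p - q))
  rw [inner_smul_right, norm_smul, Real.norm_of_nonneg hs.le] at hsq
  refine lt_of_pow_lt_pow_left₀ 2 (norm_nonneg _) ?_
  nlinarith [mul_nonneg hs.le hin, pow_pos (mul_pos hs hd) 2]

/-- The part in a closed ball of the complement of a finite union of open convex sets contained in
the open ball has finitely many connected components. -/
theorem finite_components_closedBall_diff_iUnion_convex {E ι : Type*} [NormedAddCommGroup E]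
    [InnerProductSpace ℝ E] [FiniteDimensional ℝ E] (hE : 1 < Module.rank ℝ E) [Finite ι]
    {V : ι → Set E} (hopen : ∀ i, IsOpen (V i)) (hconv : ∀ i, Convex ℝ (V i)) {R : ℝ}
    (hR : 0 ≤ R) (hVR : ∀ i, V i ⊆ ball 0 R) :
    Finite (ConnectedComponents ↥(closedBall (0 : E) R \ ⋃ i, V i)) := by
  set X : Set E := closedBall (0 : E) R \ ⋃ i, V i
  have hcompact : IsCompact X := (isCompact_closedBall 0 R).diff (isOpen_iUnion hopen)
  have := isCompact_iff_compactSpace.1 hcompact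
  have hsphere : sphere (0 : E) R ⊆ X := fun x hx =>
    ⟨sphere_subset_closedBall hx, fun hxV => by
      obtain ⟨i, hi⟩ := mem_iUnion.1 hxV
      exact (mem_ball.1 (hVR i hi)).ne (mem_sphere.1 hx)⟩
  obtain ⟨z, hz⟩ := (isConnected_sphere hE (0 : E) hR).nonempty
  let T : Set X := {x | ‖x.1‖ < R ∧ ∃ K : Set X, IsClopen K ∧ x ∈ K ∧ ∀ y ∈ K, ‖y.1‖ ≤ ‖x.1‖}
  have hinj : InjOn (fun x : X => {i | x.1 ∈ closure (V i)}) T := by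
    have key : ∀ p ∈ T, ∀ q : X, {i | p.1 ∈ closure (V i)} = {i | q.1 ∈ closure (V i)} →
        ‖q.1‖ ≤ ‖p.1‖ → p = q := by
      rintro p ⟨hpR, K, hK, hpK, hmax⟩ q hpq hle
      by_contra hne
      obtain ⟨O, hO, rfl⟩ := isOpen_induced_iff.1 hK.isOpen
      have hlim : Tendsto (fun s : ℝ => p.1 + s • (p.1 - q.1)) (𝓝[>] 0) (𝓝 p.1) := by
        have : Continuous fun s : ℝ => p.1 + s • (p.1 - q.1) := by fun_prop
        simpa using (this.tendsto 0).mono_left nhdsWithin_le_nhds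
      have hout := eventually_add_smul_sub_notMem_iUnion hopen hconv p.2.2
        (fun i hi => (Set.ext_iff.1 hpq i).1 hi)
      have hball := hlim.eventually (isOpen_ball.mem_nhds (mem_ball_zero_iff.2 hpR))
      obtain ⟨s, ⟨⟨hsV, hsR⟩, hsO⟩, hs⟩ := (((hout.and hball).and
        (hlim.eventually (hO.mem_nhds hpK))).and self_mem_nhdsWithin).exists
      exact (norm_lt_norm_add_smul_sub (fun h => hne (Subtype.ext h)) hle hs).not_ge
        (hmax ⟨_, ball_subset_closedBall hsR, hsV⟩ hsO)
    intro p hp q hq hpq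
    rcases le_total ‖q.1‖ ‖p.1‖ with hle | hle
    · exact key p hp q hpq hle
    · exact (key q hq p hpq.symm hle).symm
  have hTfin : T.Finite := Set.Finite.of_finite_image (Set.toFinite _) hinj
  refine finite_connectedComponents_of_inter_isClopen_nonempty
    (hTfin.insert ⟨z, hsphere hz⟩) fun K hK hKne => ?_
  by_cases hzK : (⟨z, hsphere hz⟩ : X) ∈ K
  · exact ⟨_, hzK, mem_insert _ _⟩
  obtain ⟨p, hpK, hmax⟩ := hK.isClosed.isCompact.exists_isMaxOn hKne
    (continuous_subtype_val.norm.continuousOn)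
  refine ⟨p, hpK, mem_insert_of_mem _ ⟨?_, K, hK, hpK, fun y hy => hmax hy⟩⟩
  refine lt_of_le_of_ne (mem_closedBall_zero_iff.1 p.2.1) fun hpR => hzK ?_
  have hpre : IsPreconnected ((↑) ⁻¹' sphere (0 : E) R : Set X) := by
    rw [← IsInducing.subtypeVal.isPreconnected_image, Subtype.image_preimage_coe,
      inter_eq_right.2 hsphere]
    exact isPreconnected_sphere hE 0 R
  exact hpre.subset_isClopen hK ⟨p, mem_sphere_zero_iff_norm.2 hpR, hpK⟩ hz

/-- The complement of a finite union of bounded open convex sets in a Euclidean space of dimension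
at least two has finitely many connected components. -/
theorem finite_components_compl_iUnion_convex {E ι : Type*} [NormedAddCommGroup E]
    [InnerProductSpace ℝ E] [FiniteDimensional ℝ E] (hE : 1 < Module.rank ℝ E) [Finite ι]
    {V : ι → Set E} (hopen : ∀ i, IsOpen (V i)) (hbdd : ∀ i, Bornology.IsBounded (V i))
    (hconv : ∀ i, Convex ℝ (V i)) :
    Finite (ConnectedComponents ↥((⋃ i, V i)ᶜ)) := by
  obtain ⟨R, hR, hVR⟩ := ((Bornology.isBounded_iUnion (s := V)).2 hbdd).subset_ball_lt 0 0
  have hfin := finite_components_closedBall_diff_iUnion_convex hE hopen hconv hR.le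
    fun i => (subset_iUnion V i).trans hVR
  have hsub : closedBall (0 : E) R \ ⋃ i, V i ⊆ (⋃ i, V i)ᶜ := fun x hx => hx.2
  have hcont := continuous_inclusion hsub
  refine Finite.of_surjective hcont.connectedComponentsMap fun c => ?_
  obtain ⟨x, rfl⟩ := ConnectedComponents.surjective_coe c
  rcases le_or_gt ‖x.1‖ R with hx | hx
  · exact ⟨((⟨x.1, mem_closedBall_zero_iff.2 hx, x.2⟩ :
      ↥(closedBall (0 : E) R \ ⋃ i, V i)) : ConnectedComponents _), rfl⟩
  have hx0 : 0 < ‖x.1‖ := hR.trans hx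
  have hray : ∀ t ∈ Icc (R / ‖x.1‖) 1, t • x.1 ∈ (⋃ i, V i)ᶜ := by
    intro t ht hmem
    have ht0 : 0 ≤ t := (div_pos hR hx0).le.trans ht.1
    have hlt := mem_ball_zero_iff.1 (hVR hmem)
    rw [norm_smul, Real.norm_of_nonneg ht0] at hlt
    exact hlt.not_ge ((div_le_iff₀ hx0).1 ht.1)
  have hr1 : R / ‖x.1‖ ≤ 1 := (div_le_one hx0).2 hx.le
  have hleft := left_mem_Icc.2 hr1
  have hnorm : ‖(R / ‖x.1‖) • x.1‖ = R := by
    rw [norm_smul, Real.norm_of_nonneg (div_pos hR hx0).le, div_mul_cancel₀ _ hx0.ne']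
  refine ⟨((⟨(R / ‖x.1‖) • x.1, mem_closedBall_zero_iff.2 hnorm.le, hray _ hleft⟩ :
    ↥(closedBall (0 : E) R \ ⋃ i, V i)) : ConnectedComponents _), ?_⟩
  refine ConnectedComponents.coe_eq_coe'.2 ?_
  have hpre : IsPreconnected (range fun t : Icc (R / ‖x.1‖) 1 =>
      (⟨t.1 • x.1, hray t.1 t.2⟩ : ↥((⋃ i, V i)ᶜ))) := by
    have : PreconnectedSpace (Icc (R / ‖x.1‖) 1) := Subtype.preconnectedSpace isPreconnected_Icc
    exact isPreconnected_range (by fun_prop)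
  exact hpre.subset_connectedComponent
    ⟨⟨1, right_mem_Icc.2 hr1⟩, Subtype.ext (one_smul ℝ x.1)⟩ ⟨⟨_, hleft⟩, rfl⟩

/-- Let `V₁, …, Vₙ` be open, bounded, convex subsets of `ℝ²`. Then the complement
`F = ℝ² \ (V₁ ∪ ⋯ ∪ Vₙ)` has only finitely many connected components. -/
theorem finite_components_of_compl_union_convex (n : ℕ)
    (V : Fin n → Set (EuclideanSpace ℝ (Fin 2)))
    (hopen : ∀ i, IsOpen (V i)) (hbdd : ∀ i, Bornology.IsBounded (V i))
    (hconv : ∀ i, Convex ℝ (V i)) :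
    Finite (ConnectedComponents ↥((⋃ i, V i)ᶜ)) :=
  finite_components_compl_iUnion_convex (by simp [← Module.finrank_eq_rank]) hopen hbdd hconv
end

section
/- Let K ⊆ ℂ be compact with ℂ \ K disconnected. Then there exists an open set A ⊆ ℂ with K ⊆ A such that for every open set V with K ⊆ V ⊆ A, some connected component of V is not simply connected. (Concretely, one may take A to be an annulus {z ∈ ℂ : ε/2 < |z − z₀| < M} centered at a point z₀ of a bounded component of ℂ \ K, where B(z₀, ε) ⊆ ℂ \ K and K ⊆ B(z₀, M).) -/
open Set Metric Bornology

theorem Complex.isPreconnected_compl_closedBall_zero (R : ℝ) :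
    IsPreconnected (closedBall (0 : ℂ) R)ᶜ := by
  have himage : (closedBall (0 : ℂ) R)ᶜ =
      (fun p : ℝ × ℝ ↦ (p.1 : ℂ) * Complex.exp (p.2 * Complex.I)) '' (Ioi R ×ˢ univ) := by
    ext z
    simp only [mem_compl_iff, mem_closedBall, dist_zero_right, not_le, mem_image, mem_prod,
      mem_Ioi, mem_univ, and_true, Prod.exists]
    constructor
    · exact fun hz ↦ ⟨‖z‖, z.arg, hz, z.norm_mul_exp_arg_mul_I⟩
    · rintro ⟨r, t, hr, rfl⟩
      rw [norm_mul, Complex.norm_exp_ofReal_mul_I, mul_one, Complex.norm_real]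
      exact hr.trans_le (le_abs_self r)
  rw [himage]
  exact (isPreconnected_Ioi.prod isPreconnected_univ).image _ (by fun_prop)

/-- If the complement of a compact plane set is disconnected, it contains a nonempty bounded
set whose frontier lies in the compact set. -/
theorem IsCompact.exists_isBounded_frontier_subset {K : Set ℂ}
    (hK : IsCompact K) (hdis : ¬ IsConnected Kᶜ) :
    ∃ U : Set ℂ, IsBounded U ∧ U.Nonempty ∧ U ⊆ Kᶜ ∧ frontier U ⊆ K := by
  obtain ⟨R, hKR⟩ := hK.isBounded.subset_closedBall 0
  have hne : (Kᶜ).Nonempty := by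
    rw [nonempty_compl]
    rintro rfl
    exact NormedSpace.unbounded_univ ℝ ℂ hK.isBounded
  have hnp : ¬ IsPreconnected Kᶜ := fun h ↦ hdis ⟨hne, h⟩
  have hfar : (closedBall (0 : ℂ) R)ᶜ ⊆ Kᶜ := compl_subset_compl.2 hKR
  have separated : ∀ u v : Set ℂ, IsOpen u → IsOpen v → Kᶜ ⊆ u ∪ v → Kᶜ ∩ (u ∩ v) = ∅ →
      ¬ Kᶜ ⊆ v → (closedBall (0 : ℂ) R)ᶜ ⊆ v →
      ∃ U : Set ℂ, IsBounded U ∧ U.Nonempty ∧ U ⊆ Kᶜ ∧ frontier U ⊆ K := by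
    intro u v hu hv huv hdisj hKv hfarv
    refine ⟨Kᶜ ∩ u, ?_, ?_, inter_subset_left, ?_⟩
    · refine (isBounded_closedBall (x := (0 : ℂ)) (r := R)).subset fun z hz ↦ ?_
      by_contra hzR
      exact (hdisj.subset ⟨hz.1, hz.2, hfarv hzR⟩ : z ∈ (∅ : Set ℂ))
    · obtain ⟨z, hz, hzv⟩ := not_subset.1 hKv
      exact ⟨z, hz, (huv hz).resolve_right hzv⟩
    · intro z hz
      by_contra hzK
      have hopen : IsOpen (Kᶜ ∩ u) := hK.isClosed.isOpen_compl.inter hu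
      rw [hopen.frontier_eq] at hz
      have hzv : z ∈ v := (huv hzK).resolve_left fun h ↦ hz.2 ⟨hzK, h⟩
      obtain ⟨w, hwv, hwK, hwu⟩ := mem_closure_iff.1 hz.1 v hv hzv
      exact (hdisj.subset ⟨hwK, hwu, hwv⟩ : w ∈ (∅ : Set ℂ))
  rw [isPreconnected_iff_subset_of_disjoint] at hnp
  push Not at hnp
  obtain ⟨u, v, hu, hv, huv, hdisj, hKu, hKv⟩ := hnp
  rcases isPreconnected_iff_subset_of_disjoint.1
    (Complex.isPreconnected_compl_closedBall_zero R) u v hu hv (hfar.trans huv)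
    (subset_empty_iff.1 ((inter_subset_inter_left _ hfar).trans hdisj.subset)) with h | h
  · exact separated v u hv hu (by rwa [union_comm]) (by rwa [inter_comm v u]) hKu h
  · exact separated u v hu hv huv hdisj hKv h

/-- A nonvanishing continuous function on the plane cannot agree with `z ↦ z - c` on a circle
centred at `c`. -/
theorem Complex.not_eqOn_sphere_sub_of_continuous {f : ℂ → ℂ} (hf : Continuous f)
    (hf₀ : ∀ z, f z ≠ 0) (c : ℂ) {R : ℝ} (hR : 0 < R) :
    ¬ EqOn f (fun z ↦ z - c) (sphere c R) := by
  intro hfc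
  have huniv : IsSimplyConnected (univ : Set ℂ) :=
    (Homeomorph.Set.univ ℂ).toHomotopyEquiv.simplyConnectedSpace
  obtain ⟨g, hg, hgf⟩ := Complex.exists_continuousOn_eqOn_exp_comp huniv isOpen_univ
    hf.continuousOn (by simpa using hf₀)
  rw [continuousOn_univ] at hg
  have hexp : ∀ t : ℝ, Complex.exp (g (circleMap c R t)) = R * Complex.exp (t * Complex.I) := by
    intro t
    have h := hgf (mem_univ (circleMap c R t))
    rw [Function.comp_apply, hfc (circleMap_mem_sphere c hR.le t)] at h
    simpa [circleMap] using h
  have hlift : (fun t : ℝ ↦ g (circleMap c R t)) =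
      fun t : ℝ ↦ g (circleMap c R 0) + t * Complex.I := by
    refine Complex.isCoveringMap_exp.eq_of_comp_eq (by fun_prop) (by fun_prop) ?_ 0 (by simp)
    ext t
    simp only [Function.comp_apply]
    rw [Complex.exp_add, hexp, hexp]
    simp
  have hend := congrFun hlift (2 * Real.pi)
  have hperiod : circleMap c R (2 * Real.pi) = circleMap c R 0 := by
    simpa using periodic_circleMap c R 0
  simp [hperiod] at hend

/-- On an open plane set with simply connected components, every nonvanishing continuous function
has a continuous logarithm. -/
theorem Complex.exists_continuousOn_exp_eq_of_simplyConnected_components {V : Set ℂ}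
    (hV : IsOpen V) (hsc : ∀ z ∈ V, SimplyConnectedSpace (connectedComponentIn V z))
    {g : ℂ → ℂ} (hg : ContinuousOn g V) (hg₀ : ∀ z ∈ V, g z ≠ 0) :
    ∃ l : ℂ → ℂ, ContinuousOn l V ∧ ∀ z ∈ V, Complex.exp (l z) = g z := by
  have hcomp : ∀ C : Set ℂ, ∃ l : ℂ → ℂ, ∀ z ∈ V, C = connectedComponentIn V z →
      ContinuousOn l C ∧ EqOn (Complex.exp ∘ l) g C := by
    intro C
    by_cases hC : ∃ z ∈ V, C = connectedComponentIn V z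
    · obtain ⟨z, hz, rfl⟩ := hC
      have hsub := connectedComponentIn_subset V z
      obtain ⟨l, hl⟩ := Complex.exists_continuousOn_eqOn_exp_comp (hsc z hz)
        hV.connectedComponentIn (hg.mono hsub)
        (by rintro ⟨w, hw, hw₀⟩; exact hg₀ w (hsub hw) hw₀)
      exact ⟨l, fun _ _ _ ↦ hl⟩
    · exact ⟨0, fun z hz h ↦ (hC ⟨z, hz, h⟩).elim⟩
  choose L hL using hcomp
  refine ⟨fun z ↦ L (connectedComponentIn V z) z, fun z hz ↦ ?_, fun z hz ↦ ?_⟩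
  · have hnhds : connectedComponentIn V z ∈ nhds z :=
      hV.connectedComponentIn.mem_nhds (mem_connectedComponentIn hz)
    refine (ContinuousAt.congr ((hL _ z hz rfl).1.continuousAt hnhds) ?_).continuousWithinAt
    filter_upwards [hnhds] with w hw
    rw [connectedComponentIn_eq hw]
  · exact (hL _ z hz rfl).2 (mem_connectedComponentIn hz)

/-- Let `K ⊆ ℂ` be compact with `ℂ \ K` disconnected. Then there exists an open set
`A ⊇ K` such that for every open set `V` with `K ⊆ V ⊆ A`, some connected component
of `V` is not simply connected. -/
theorem exists_open_no_simplyConnected_refinement (K : Set ℂ) (hK : IsCompact K)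
    (hdis : ¬ IsConnected Kᶜ) :
    ∃ A : Set ℂ, IsOpen A ∧ K ⊆ A ∧
      ∀ V : Set ℂ, IsOpen V → K ⊆ V → V ⊆ A →
        ∃ z ∈ V, ¬ SimplyConnectedSpace (connectedComponentIn V z) := by
  classical
  obtain ⟨U, hUb, ⟨c, hcU⟩, hUK, hfr⟩ := hK.exists_isBounded_frontier_subset hdis
  refine ⟨{c}ᶜ, isOpen_compl_singleton, fun z hz hzc ↦ hUK hcU (hzc ▸ hz), ?_⟩
  intro V hV hKV hVc
  by_contra! hsc
  obtain ⟨l, hl, hlexp⟩ := Complex.exists_continuousOn_exp_eq_of_simplyConnected_components hV hsc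
    (g := fun z ↦ z - c) (by fun_prop) fun z hz ↦ sub_ne_zero.2 (hVc hz)
  obtain ⟨m, hm⟩ := ContinuousMap.exists_restrict_eq hK.isClosed
    ⟨K.domRestrict l, (hl.mono hKV).domRestrict⟩
  have hmK : ∀ z ∈ K, m z = l z := fun z hz ↦ congr($hm ⟨z, hz⟩)
  have hcont : Continuous (U.piecewise (fun z ↦ Complex.exp (m z)) fun z ↦ z - c) := by
    refine Continuous.piecewise (fun z hz ↦ ?_) (by fun_prop) (by fun_prop)
    rw [hmK z (hfr hz), hlexp z (hKV (hfr hz))]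
  obtain ⟨R, hR, hUR⟩ := hUb.subset_ball_lt 0 c
  refine Complex.not_eqOn_sphere_sub_of_continuous hcont (fun z ↦ ?_) c hR fun z hz ↦ ?_
  · by_cases hz : z ∈ U
    · simp [hz]
    · simpa [hz, sub_eq_zero] using fun h : z = c ↦ hz (h ▸ hcU)
  · refine piecewise_eq_of_notMem _ _ _ fun hzU ↦ ?_
    exact (mem_ball.1 (hUR hzU)).ne (mem_sphere.1 hz)
end
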